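/- arXiv:1608.07571 — 2 statements merged into one kernel-verified Lean document; each statement's English description precedes it below -/
import Mathlib

section
/- The ink-spots theorem for slanted kinetic cylinders: there exists a constant c ∈ (0,1), depending only on d and s, such that the following holds. Let μ ∈ (0,1), m ≥ 1, and let E ⊆ F be bounded Lebesgue measurable subsets of ℝ × ℝ^d × ℝ^d such that (i) E ⊆ Q₁ and |E| < (1−μ)|Q₁|, and (ii) every slanted kinetic cylinder Q = Q_r(z₀) with Q ⊆ Q₁ and |Q ∩ E| ≥ (1−μ)|Q| satisfies Q̄^m(z₀,r) ⊆ F. Then |E| ≤ ((m+1)/m) (1 − cμ) |F|. -/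
open MeasureTheory Metric Set

noncomputable section

/-- Kinetic phase space `ℝ × ℝ^d × ℝ^d` with variables `z = (t, x, v)`. -/
abbrev Phase (d : ℕ) := ℝ × EuclideanSpace ℝ (Fin d) × EuclideanSpace ℝ (Fin d)

/-- The slanted kinetic cylinder `Q_r(z₀)` of radius `r` centered at `z₀ = (t₀,x₀,v₀)`. -/
def kinCyl (d : ℕ) (s : ℝ) (z₀ : Phase d) (r : ℝ) : Set (Phase d) :=
  {z | z₀.1 - r ^ (2 * s) < z.1 ∧ z.1 ≤ z₀.1 ∧ dist z.2.2 z₀.2.2 < r ∧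
       ‖z.2.1 - z₀.2.1 - (z.1 - z₀.1) • z₀.2.2‖ < r ^ (1 + 2 * s)}

/-- The unit cylinder `Q₁ = (-1,0] × B₁ × B₁` centered at the origin. -/
def unitCyl (d : ℕ) (s : ℝ) : Set (Phase d) := kinCyl d s (0 : Phase d) 1

/-- The stacked (time-delayed) cylinder `Q̄^m(z₀, r)` associated with `Q_r(z₀)`. -/
def kinCylStack (d : ℕ) (s m : ℝ) (z₀ : Phase d) (r : ℝ) : Set (Phase d) :=
  {z | 0 < z.1 - z₀.1 ∧ z.1 - z₀.1 ≤ m * r ^ (2 * s) ∧ dist z.2.2 z₀.2.2 < r ∧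
       ‖z.2.1 - z₀.2.1 - (z.1 - z₀.1) • z₀.2.2‖ < (m + 2) * r ^ (1 + 2 * s)}


lemma ink_finite (ν : Measure ℝ) (lam : ENNReal) (J : Finset (ℝ × ℝ))
    (hlt : ∀ j ∈ J, j.1 < j.2)
    (hP : ∀ j ∈ J, ∀ t, j.1 ≤ t → t < j.2 →
      lam * ENNReal.ofReal (j.2 - t) ≤ ν (Ioo t j.2)) :
    ∀ t, lam * volume ((⋃ j ∈ J, Ioo j.1 j.2) ∩ Ioi t) ≤
      ν ((⋃ j ∈ J, Ioo j.1 j.2) ∩ Ioi t) := by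
  classical
  induction J using Finset.induction_on_min_value (fun j : ℝ × ℝ => j.1) with
  | empty => simp
  | insert a J haJ hmin ih =>
    have ih' := ih (fun j hj => hlt j (Finset.mem_insert_of_mem hj))
      (fun j hj => hP j (Finset.mem_insert_of_mem hj))
    intro t
    set U := ⋃ j ∈ J, Ioo j.1 j.2 with hU
    have hins : (⋃ j ∈ insert a J, Ioo j.1 j.2) = Ioo a.1 a.2 ∪ U := by
      simp [hU]
    rw [hins]
    have haa := hlt a (Finset.mem_insert_self _ _)
    have hUm : MeasurableSet U := by
      rw [hU]; exact Finset.measurableSet_biUnion _ (fun _ _ => measurableSet_Ioo)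
    rcases le_or_gt a.2 t with h | h
    · have : (Ioo a.1 a.2 ∪ U) ∩ Ioi t = U ∩ Ioi t := by
        ext y
        simp only [mem_inter_iff, mem_union, mem_Ioo, mem_Ioi]
        constructor
        · rintro ⟨h1 | h1, h2⟩
          · linarith [h1.2]
          · exact ⟨h1, h2⟩
        · rintro ⟨h1, h2⟩
          exact ⟨Or.inr h1, h2⟩
      rw [this]
      exact ih' t
    · set t' := max t a.1 with ht'
      have h1 : t' < a.2 := max_lt h haa
      have hUp : ∀ y ∈ U, a.1 < y := by
        intro y hy
        simp only [hU, mem_iUnion, mem_Ioo] at hy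
        obtain ⟨j, hj, hy1, hy2⟩ := hy
        exact lt_of_le_of_lt (hmin j hj) hy1
      have hsub : (Ioo a.1 a.2 ∪ U) ∩ Ioi t ⊆ Ioo t' a.2 ∪ ({a.2} ∪ U ∩ Ioi a.2) := by
        rintro y ⟨hy, hyt⟩
        have hya : a.1 < y := by
          rcases hy with hy | hy
          · exact hy.1
          · exact hUp y hy
        rcases lt_trichotomy y a.2 with h2 | h2 | h2
        · left; exact ⟨max_lt hyt hya, h2⟩
        · right; left; exact h2
        · right; right
          rcases hy with hy | hy
          · linarith [hy.2]
          · exact ⟨hy, h2⟩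
      have hsup : Ioo t' a.2 ∪ (U ∩ Ioi a.2) ⊆ (Ioo a.1 a.2 ∪ U) ∩ Ioi t := by
        rintro y (hy | hy)
        · exact ⟨Or.inl ⟨lt_of_le_of_lt (le_max_right _ _) hy.1, hy.2⟩,
            lt_of_le_of_lt (le_max_left _ _) hy.1⟩
        · exact ⟨Or.inr hy.1, lt_trans h hy.2⟩
      have hdis : Disjoint (Ioo t' a.2) (U ∩ Ioi a.2) := by
        rw [Set.disjoint_left]
        rintro y hy1 hy2
        exact lt_asymm hy1.2 hy2.2
      calc lam * volume ((Ioo a.1 a.2 ∪ U) ∩ Ioi t)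
          ≤ lam * (ENNReal.ofReal (a.2 - t') + volume (U ∩ Ioi a.2)) := by
            gcongr
            refine (measure_mono hsub).trans ((measure_union_le _ _).trans ?_)
            rw [Real.volume_Ioo]
            refine add_le_add le_rfl ?_
            refine (measure_union_le _ _).trans ?_
            simp
        _ = lam * ENNReal.ofReal (a.2 - t') + lam * volume (U ∩ Ioi a.2) := by rw [mul_add]
        _ ≤ ν (Ioo t' a.2) + ν (U ∩ Ioi a.2) :=
            add_le_add (hP a (Finset.mem_insert_self _ _) t' (le_max_right _ _) h1) (ih' _)
        _ = ν (Ioo t' a.2 ∪ (U ∩ Ioi a.2)) :=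
            (measure_union hdis (hUm.inter measurableSet_Ioi)).symm
        _ ≤ _ := measure_mono hsup

lemma ink_1d (m : ℝ) (hm : 0 < m) (S T : Set ℝ)
    (h : ∀ t ∈ S, ∃ a h : ℝ, 0 < h ∧ a - h < t ∧ t ≤ a ∧ Ioc a (a + m * h) ⊆ T) :
    volume S ≤ ENNReal.ofReal ((m + 1) / m) * volume T := by
  classical
  choose! a h hh h1 h2 h3 using h
  set lam := ENNReal.ofReal (m / (m + 1)) with hlam
  set V := ⋃ t : S, Ioo (a t - h t) (a t + m * h t) with hV
  have hVo : IsOpen V := isOpen_iUnion (fun _ => isOpen_Ioo)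
  have hSV : S ⊆ V := by
    intro t ht
    refine mem_iUnion.2 ⟨⟨t, ht⟩, h1 t ht, ?_⟩
    have := mul_pos hm (hh t ht)
    have := h2 t ht
    simp only
    linarith
  have key : lam * volume V ≤ volume T := by
    rw [hVo.measure_eq_iSup_isCompact, ENNReal.mul_iSup]
    refine iSup_le fun K => ?_
    rw [ENNReal.mul_iSup]
    refine iSup_le fun hKV => ?_
    rw [ENNReal.mul_iSup]
    refine iSup_le fun hK => ?_
    obtain ⟨J, hJ⟩ := hK.elim_finite_subcover _ (fun _ => isOpen_Ioo) hKV
    set J' : Finset (ℝ × ℝ) := J.image (fun t : S => (a t - h t, a t + m * h t)) with hJ'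
    have fin := ink_finite (volume.restrict T) lam J' ?_ ?_
    · have hKJ : K ⊆ ⋃ j ∈ J', Ioo j.1 j.2 := by
        refine hJ.trans ?_
        intro y hy
        simp only [mem_iUnion] at hy
        obtain ⟨i, hi, hy⟩ := hy
        simp only [mem_iUnion]
        exact ⟨_, Finset.mem_image_of_mem _ hi, hy⟩
      obtain ⟨b, hb⟩ := hK.bddBelow
      calc lam * volume K ≤ lam * volume ((⋃ j ∈ J', Ioo j.1 j.2) ∩ Ioi (b - 1)) := by
            gcongr
            intro y hy
            exact ⟨hKJ hy, by have := hb hy; simp only [mem_Ioi]; linarith⟩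
        _ ≤ _ := fin _
        _ ≤ volume.restrict T univ := measure_mono (subset_univ _)
        _ = volume T := by simp
    · intro j hj
      obtain ⟨i, hi, rfl⟩ := Finset.mem_image.1 hj
      have := hh i i.2
      have := mul_pos hm this
      simp only; linarith
    · intro j hj
      obtain ⟨i, hi, rfl⟩ := Finset.mem_image.1 hj
      intro t ht1 ht2
      simp only at ht1 ht2 ⊢
      have hpos := hh i i.2
      have hmp := mul_pos hm hpos
      have hsub : Ioo (max t (a i)) (a i + m * h i) ⊆ Ioo t (a i + m * h i) ∩ T := by
        intro y hy
        refine ⟨⟨lt_of_le_of_lt (le_max_left _ _) hy.1, hy.2⟩, h3 i i.2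
          ⟨lt_of_le_of_lt (le_max_right _ _) hy.1, hy.2.le⟩⟩
      rw [Measure.restrict_apply measurableSet_Ioo]
      refine le_trans ?_ (measure_mono hsub)
      rw [Real.volume_Ioo, hlam, ← ENNReal.ofReal_mul (by positivity)]
      apply ENNReal.ofReal_le_ofReal
      rw [div_mul_eq_mul_div, div_le_iff₀ (by positivity)]
      rcases le_total t (a i) with h4 | h4
      · rw [max_eq_right h4]
        nlinarith
      · rw [max_eq_left h4]
        nlinarith
  have hl : ENNReal.ofReal ((m + 1) / m) * lam = 1 := by
    rw [hlam, ← ENNReal.ofReal_mul (by positivity)]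
    rw [div_mul_div_comm, mul_comm, div_self (by positivity), ENNReal.ofReal_one]
  calc volume S ≤ volume V := measure_mono hSV
    _ = ENNReal.ofReal ((m + 1) / m) * (lam * volume V) := by rw [← mul_assoc, hl, one_mul]
    _ ≤ _ := by gcongr

/-- The straightening map at a base point. -/
def ink_str (d : ℕ) (z₀ : Phase d) (z : Phase d) : Phase d :=
  (z.1, z.2 + (-z₀.2.1 - (z.1 - z₀.1) • z₀.2.2, -z₀.2.2))

lemma ink_str_mp (d : ℕ) (z₀ : Phase d) :
    MeasurePreserving (ink_str d z₀) (volume : Measure (Phase d)) volume := by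
  have h := MeasurePreserving.skew_product (μa := (volume : Measure ℝ)) (μb := volume)
    (μc := (volume : Measure (EuclideanSpace ℝ (Fin d) × EuclideanSpace ℝ (Fin d))))
    (μd := volume) (f := id) (MeasurePreserving.id _)
    (g := fun t w => w + (-z₀.2.1 - (t - z₀.1) • z₀.2.2, -z₀.2.2))
    (by
      apply Continuous.measurable
      unfold Function.uncurry
      fun_prop)
    (Filter.Eventually.of_forall fun t => (measurePreserving_add_right
      (Measure.prod (volume : Measure (EuclideanSpace ℝ (Fin d))) volume) _).map_eq)
  exact h

/-- General slanted boxes. -/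
def ink_slab (d : ℕ) (z₀ : Phase d) (α β b e : ℝ) : Set (Phase d) :=
  {z | z₀.1 - α < z.1 ∧ z.1 ≤ z₀.1 + β ∧ dist z.2.2 z₀.2.2 < b ∧
       ‖z.2.1 - z₀.2.1 - (z.1 - z₀.1) • z₀.2.2‖ < e}

lemma ink_slab_eq (d : ℕ) (z₀ : Phase d) (α β b e : ℝ) :
    ink_slab d z₀ α β b e = ink_str d z₀ ⁻¹'
      (Ioc (z₀.1 - α) (z₀.1 + β) ×ˢ (ball 0 e ×ˢ ball 0 b)) := by
  ext z
  simp only [ink_slab, ink_str, mem_ofPred_eq, mem_preimage, mem_prod, mem_Ioc, mem_ball_zero_iff,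
    Prod.fst_add, Prod.snd_add, dist_eq_norm]
  rw [show z.2.1 + (-z₀.2.1 - (z.1 - z₀.1) • z₀.2.2) =
    z.2.1 - z₀.2.1 - (z.1 - z₀.1) • z₀.2.2 by abel, ← sub_eq_add_neg]
  tauto

lemma ink_slab_meas (d : ℕ) (z₀ : Phase d) (α β b e : ℝ) :
    MeasurableSet (ink_slab d z₀ α β b e) := by
  rw [ink_slab_eq]
  exact (ink_str_mp d z₀).measurable
    (measurableSet_Ioc.prod (measurableSet_ball.prod measurableSet_ball))

lemma ink_slab_vol (d : ℕ) (hd : 1 ≤ d) (z₀ : Phase d) (α β b e : ℝ) (hb : 0 ≤ b) (he : 0 ≤ e) :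
    volume (ink_slab d z₀ α β b e) = ENNReal.ofReal (α + β) * (ENNReal.ofReal (e ^ d) *
      ENNReal.ofReal (b ^ d)) * (volume (ball (0 : EuclideanSpace ℝ (Fin d)) 1)) ^ 2 := by
  have : Nonempty (Fin d) := ⟨⟨0, hd⟩⟩
  rw [ink_slab_eq, (ink_str_mp d z₀).measure_preimage
    (measurableSet_Ioc.prod (measurableSet_ball.prod measurableSet_ball)).nullMeasurableSet,
    Measure.volume_eq_prod, Measure.prod_prod, Measure.volume_eq_prod, Measure.prod_prod,
    Measure.addHaar_ball _ _ hb, Measure.addHaar_ball _ _ he, Real.volume_Ioc]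
  simp only [finrank_euclideanSpace, Fintype.card_fin]
  rw [show z₀.1 + β - (z₀.1 - α) = α + β by ring]
  ring

lemma ink_cyl_eq (d : ℕ) (s : ℝ) (z₀ : Phase d) (r : ℝ) :
    kinCyl d s z₀ r = ink_slab d z₀ (r ^ (2 * s)) 0 r (r ^ (1 + 2 * s)) := by
  simp [kinCyl, ink_slab]

lemma ink_cyl_meas (d : ℕ) (s : ℝ) (z₀ : Phase d) (r : ℝ) : MeasurableSet (kinCyl d s z₀ r) := by
  rw [ink_cyl_eq]; exact ink_slab_meas _ _ _ _ _ _

lemma ink_cyl_vol (d : ℕ) (hd : 1 ≤ d) (s : ℝ) (z₀ : Phase d) (r : ℝ) (hr : 0 < r) :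
    volume (kinCyl d s z₀ r) = ENNReal.ofReal (r ^ (2 * s)) * (ENNReal.ofReal ((r ^ (1 + 2 * s)) ^ d) *
      ENNReal.ofReal (r ^ d)) * (volume (ball (0 : EuclideanSpace ℝ (Fin d)) 1)) ^ 2 := by
  rw [ink_cyl_eq, ink_slab_vol d hd _ _ _ _ _ hr.le (by positivity), add_zero]

lemma ink_cyl_vol_pos (d : ℕ) (hd : 1 ≤ d) (s : ℝ) (z₀ : Phase d) (r : ℝ) (hr : 0 < r) :
    0 < volume (kinCyl d s z₀ r) := by
  rw [ink_cyl_vol d hd s z₀ r hr]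
  have h1 : 0 < ENNReal.ofReal (r ^ (2 * s)) := ENNReal.ofReal_pos.2 (by positivity)
  have h2 : 0 < ENNReal.ofReal ((r ^ (1 + 2 * s)) ^ d) := ENNReal.ofReal_pos.2 (by positivity)
  have h3 : 0 < ENNReal.ofReal (r ^ d) := ENNReal.ofReal_pos.2 (by positivity)
  have h4 : 0 < volume (ball (0 : EuclideanSpace ℝ (Fin d)) 1) := measure_ball_pos _ _ one_pos
  positivity

lemma ink_cyl_vol_lt (d : ℕ) (hd : 1 ≤ d) (s : ℝ) (z₀ : Phase d) (r : ℝ) (hr : 0 < r) :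
    volume (kinCyl d s z₀ r) < ⊤ := by
  rw [ink_cyl_vol d hd s z₀ r hr]
  have h4 : volume (ball (0 : EuclideanSpace ℝ (Fin d)) 1) < ⊤ := measure_ball_lt_top
  exact ENNReal.mul_lt_top (ENNReal.mul_lt_top ENNReal.ofReal_lt_top
    (ENNReal.mul_lt_top ENNReal.ofReal_lt_top ENNReal.ofReal_lt_top)) (ENNReal.pow_lt_top h4)

/-- The point at time `t` on the trajectory with label `w = (y, v)`. -/
def ink_traj (d : ℕ) (p : Phase d) : Phase d := (p.1, p.2.1 + p.1 • p.2.2, p.2.2)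

lemma ink_traj_cont (d : ℕ) : Continuous (ink_traj d) := by
  unfold ink_traj; fun_prop

lemma ink_traj_mp (d : ℕ) :
    MeasurePreserving (ink_traj d) (volume : Measure (Phase d)) volume := by
  have h2 : ∀ t : ℝ, MeasurePreserving
      (fun w : EuclideanSpace ℝ (Fin d) × EuclideanSpace ℝ (Fin d) => (w.1 + t • w.2, w.2))
      volume volume := by
    intro t
    have h := MeasurePreserving.skew_product (μa := (volume : Measure (EuclideanSpace ℝ (Fin d))))
      (μb := volume) (μc := (volume : Measure (EuclideanSpace ℝ (Fin d))))
      (μd := volume) (f := id) (MeasurePreserving.id _)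
      (g := fun v y => y + t • v)
      (by
        apply Continuous.measurable
        unfold Function.uncurry
        fun_prop)
      (Filter.Eventually.of_forall fun v => (measurePreserving_add_right _ _).map_eq)
    have h3 := (Measure.measurePreserving_swap (μ := (volume : Measure (EuclideanSpace ℝ (Fin d))))
      (ν := (volume : Measure (EuclideanSpace ℝ (Fin d))))).comp (h.comp
        Measure.measurePreserving_swap)
    exact h3
  have h := MeasurePreserving.skew_product (μa := (volume : Measure ℝ)) (μb := volume)
    (μc := (volume : Measure (EuclideanSpace ℝ (Fin d) × EuclideanSpace ℝ (Fin d))))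
    (μd := volume) (f := id) (MeasurePreserving.id _)
    (g := fun t w => (w.1 + t • w.2, w.2))
    (by
      apply Continuous.measurable
      unfold Function.uncurry
      fun_prop)
    (Filter.Eventually.of_forall fun t => (h2 t).map_eq)
  exact h

/-- The fiber of a set along a trajectory. -/
def ink_fib (d : ℕ) (S : Set (Phase d)) (w : EuclideanSpace ℝ (Fin d) × EuclideanSpace ℝ (Fin d)) :
    Set ℝ := {t | ink_traj d (t, w) ∈ S}

lemma ink_fib_vol (d : ℕ) (S : Set (Phase d)) (hS : MeasurableSet S) :
    volume S = ∫⁻ w, volume (ink_fib d S w) := by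
  rw [← (ink_traj_mp d).measure_preimage hS.nullMeasurableSet, Measure.volume_eq_prod,
    Measure.prod_apply_symm ((ink_traj_mp d).measurable hS)]
  rfl

lemma ink_fib_meas (d : ℕ) (S : Set (Phase d)) (hS : MeasurableSet S) :
    Measurable (fun w => volume (ink_fib d S w)) :=
  measurable_measure_prodMk_right ((ink_traj_mp d).measurable hS)

/-- `z` is close, at scale `r`, to the cylinder with center `c`. -/
def ink_near (d : ℕ) (s : ℝ) (z c : Phase d) (r : ℝ) : Prop :=
  |z.1 - c.1| ≤ r ^ (2 * s) ∧ dist z.2.2 c.2.2 < r ∧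
    ‖z.2.1 - c.2.1 - (z.1 - c.1) • c.2.2‖ < 2 * r ^ (1 + 2 * s)

lemma ink_rpow_split (s r : ℝ) (hr : 0 < r) : r ^ (1 + 2 * s) = r * r ^ (2 * s) := by
  rw [Real.rpow_add hr, Real.rpow_one]

lemma ink_rpow_le (s : ℝ) (hs : s ∈ Ioo (0 : ℝ) 1) (r r' : ℝ) (hr : 0 < r) (hr' : 0 < r')
    (h : r ≤ 2 * r') : r ^ (2 * s) ≤ 4 * r' ^ (2 * s) := by
  have h1 : r ^ (2 * s) ≤ (2 * r') ^ (2 * s) :=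
    Real.rpow_le_rpow hr.le h (by linarith [hs.1])
  rw [Real.mul_rpow (by norm_num) hr'.le] at h1
  have h2 : (2 : ℝ) ^ (2 * s) ≤ 2 ^ (2 : ℝ) :=
    Real.rpow_le_rpow_of_exponent_le (by norm_num) (by linarith [hs.2])
  have h3 : (2 : ℝ) ^ (2 : ℝ) = 4 := by norm_num
  rw [h3] at h2
  have : 0 < r' ^ (2 * s) := by positivity
  nlinarith

lemma ink_engulf (d : ℕ) (s : ℝ) (hs : s ∈ Ioo (0 : ℝ) 1) (z c c' : Phase d) (r r' : ℝ)
    (hr : 0 < r) (hr' : 0 < r') (h : r ≤ 2 * r') (hn : ink_near d s z c r)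
    (hne : (kinCyl d s c r ∩ kinCyl d s c' r').Nonempty) :
    z ∈ ink_slab d c' (50 * r' ^ (2 * s)) (50 * r' ^ (2 * s)) (50 * r') (50 * r' ^ (1 + 2 * s)) := by
  obtain ⟨w, ⟨hw1, hw2, hw3, hw4⟩, ⟨hv1, hv2, hv3, hv4⟩⟩ := hne
  obtain ⟨hn1, hn2, hn3⟩ := hn
  have hA := ink_rpow_le s hs r r' hr hr' h
  have hA0 : 0 < r ^ (2 * s) := by positivity
  have hA0' : 0 < r' ^ (2 * s) := by positivity
  rw [ink_rpow_split s r hr] at hw4 hn3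
  rw [ink_rpow_split s r' hr'] at hv4 ⊢
  set A := r ^ (2 * s)
  set A' := r' ^ (2 * s)
  have hB : r * A ≤ 8 * (r' * A') := by
    calc r * A ≤ (2 * r') * (4 * A') := by gcongr
      _ = _ := by ring
  rw [abs_le] at hn1
  refine ⟨by linarith, by linarith, ?_, ?_⟩
  · have h1 := dist_triangle4 z.2.2 c.2.2 w.2.2 c'.2.2
    rw [dist_comm c.2.2 w.2.2] at h1
    linarith
  · have e : z.2.1 - c'.2.1 - (z.1 - c'.1) • c'.2.2 =
        (z.2.1 - c.2.1 - (z.1 - c.1) • c.2.2) - (w.2.1 - c.2.1 - (w.1 - c.1) • c.2.2)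
        + (w.2.1 - c'.2.1 - (w.1 - c'.1) • c'.2.2) + (z.1 - w.1) • (c.2.2 - c'.2.2) := by
      module
    have h1 : |z.1 - w.1| ≤ 8 * A' := by rw [abs_le]; constructor <;> linarith
    have h2 : ‖c.2.2 - c'.2.2‖ ≤ 3 * r' := by
      rw [← dist_eq_norm]
      have h1 := dist_triangle c.2.2 w.2.2 c'.2.2
      rw [dist_comm c.2.2 w.2.2] at h1
      linarith
    have h3 : ‖(z.1 - w.1) • (c.2.2 - c'.2.2)‖ ≤ 24 * (r' * A') := by
      rw [norm_smul, Real.norm_eq_abs]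
      calc _ ≤ (8 * A') * (3 * r') := by gcongr
        _ = _ := by ring
    rw [e]
    have h4 := norm_add_le ((z.2.1 - c.2.1 - (z.1 - c.1) • c.2.2) -
      (w.2.1 - c.2.1 - (w.1 - c.1) • c.2.2)
        + (w.2.1 - c'.2.1 - (w.1 - c'.1) • c'.2.2)) ((z.1 - w.1) • (c.2.2 - c'.2.2))
    have h5 := norm_add_le ((z.2.1 - c.2.1 - (z.1 - c.1) • c.2.2) -
      (w.2.1 - c.2.1 - (w.1 - c.1) • c.2.2)) (w.2.1 - c'.2.1 - (w.1 - c'.1) • c'.2.2)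
    have h6 := norm_sub_le (z.2.1 - c.2.1 - (z.1 - c.1) • c.2.2)
      (w.2.1 - c.2.1 - (w.1 - c.1) • c.2.2)
    have : 0 < r' * A' := by positivity
    linarith

/-- The covering constant. -/
def ink_C (d : ℕ) : ℝ := 100 * (50 ^ d * 50 ^ d)

lemma ink_C_ge (d : ℕ) : 100 ≤ ink_C d := by
  unfold ink_C
  have : (1 : ℝ) ≤ 50 ^ d := one_le_pow₀ (by norm_num)
  nlinarith

lemma ink_big_vol (d : ℕ) (hd : 1 ≤ d) (s : ℝ) (c : Phase d) (r : ℝ) (hr : 0 < r) :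
    volume (ink_slab d c (50 * r ^ (2 * s)) (50 * r ^ (2 * s)) (50 * r) (50 * r ^ (1 + 2 * s))) =
      ENNReal.ofReal (ink_C d) * volume (kinCyl d s c r) := by
  rw [ink_slab_vol d hd _ _ _ _ _ (by positivity) (by positivity), ink_cyl_vol d hd s c r hr, ink_C,
    ENNReal.ofReal_mul (by norm_num), ENNReal.ofReal_mul (p := (50 : ℝ) ^ d) (by positivity),
    mul_pow, mul_pow, ENNReal.ofReal_mul (p := (50 : ℝ) ^ d) (by positivity),
    ENNReal.ofReal_mul (p := (50 : ℝ) ^ d) (by positivity),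
    show 50 * r ^ (2 * s) + 50 * r ^ (2 * s) = 100 * r ^ (2 * s) by ring,
    ENNReal.ofReal_mul (p := (100 : ℝ)) (by positivity)]
  ring

lemma ink_vitali (d : ℕ) (hd : 1 ≤ d) (s : ℝ) (hs : s ∈ Ioo (0 : ℝ) 1) (D W : Set (Phase d))
    (hW : MeasurableSet W) (η : ENNReal) (c : Phase d → Phase d) (r : Phase d → ℝ)
    (hr : ∀ z ∈ D, 0 < r z) (hr1 : ∀ z ∈ D, r z ≤ 1) (hn : ∀ z ∈ D, ink_near d s z (c z) (r z))
    (hη : ∀ z ∈ D, η * volume (kinCyl d s (c z) (r z)) ≤ volume (kinCyl d s (c z) (r z) ∩ W)) :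
    ∃ u ⊆ D, u.Countable ∧ η * volume D ≤
      ENNReal.ofReal (ink_C d) * volume ((⋃ z ∈ u, kinCyl d s (c z) (r z)) ∩ W) := by
  obtain ⟨u, huD, hdis, hu⟩ := Vitali.exists_disjoint_subfamily_covering_enlargement
    (fun z => kinCyl d s (c z) (r z)) D r 2 (by norm_num) (fun z hz => (hr z hz).le) 1 hr1
    (fun z hz => nonempty_of_measure_ne_zero (ink_cyl_vol_pos d hd s (c z) (r z) (hr z hz)).ne')
  have huc : u.Countable := by
    have := Measure.countable_meas_pos_of_disjoint_iUnion (μ := (volume : Measure (Phase d)))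
      (As := fun z : u => kinCyl d s (c z) (r z)) (fun z => ink_cyl_meas _ _ _ _)
      (fun a b hab => hdis a.2 b.2 (fun h => hab (Subtype.ext h)))
    rw [show {i : u | 0 < volume (kinCyl d s (c i) (r i))} = univ from
      eq_univ_of_forall fun z => ink_cyl_vol_pos d hd s _ _ (hr z (huD z.2))] at this
    exact countable_coe_iff.1 (countable_univ_iff.1 this)
  refine ⟨u, huD, huc, ?_⟩
  have hDsub : D ⊆ ⋃ z ∈ u, ink_slab d (c z) (50 * r z ^ (2 * s)) (50 * r z ^ (2 * s)) (50 * r z)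
      (50 * r z ^ (1 + 2 * s)) := by
    intro z hz
    obtain ⟨b, hb, hne, hle⟩ := hu z hz
    exact mem_iUnion₂.2 ⟨b, hb, ink_engulf d s hs z (c z) (c b) (r z) (r b) (hr z hz)
      (hr b (huD hb)) hle (hn z hz) hne⟩
  have hD : volume D ≤ ENNReal.ofReal (ink_C d) * ∑' z : u, volume (kinCyl d s (c z) (r z)) := by
    refine (measure_mono hDsub).trans ((measure_biUnion_le _ huc _).trans ?_)
    rw [← ENNReal.tsum_mul_left]
    exact ENNReal.tsum_le_tsum fun z => (ink_big_vol d hd s _ _ (hr z (huD z.2))).le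
  calc η * volume D ≤ η * (ENNReal.ofReal (ink_C d) * ∑' z : u, volume (kinCyl d s (c z) (r z))) := by
        gcongr
    _ = ENNReal.ofReal (ink_C d) * ∑' z : u, η * volume (kinCyl d s (c z) (r z)) := by
        rw [ENNReal.tsum_mul_left]; ring
    _ ≤ ENNReal.ofReal (ink_C d) * ∑' z : u, volume (kinCyl d s (c z) (r z) ∩ W) := by
        gcongr with z
        exact hη z (huD z.2)
    _ = _ := by
        rw [iUnion₂_inter, measure_biUnion huc
          (fun a ha b hb hab => (hdis ha hb hab).mono inter_subset_left inter_subset_left)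
          (fun b _ => (ink_cyl_meas _ _ _ _).inter hW)]

lemma ink_shrink (d : ℕ) (s : ℝ) (hs : s ∈ Ioo (0 : ℝ) 1) (U : Set (Phase d)) (hU : IsOpen U)
    (z : Phase d) (hz : z ∈ U) :
    ∀ᶠ r in nhdsWithin (0 : ℝ) (Ioi 0), ∀ c, ink_near d s z c r → kinCyl d s c r ⊆ U := by
  obtain ⟨δ, hδ, hb⟩ := Metric.isOpen_iff.1 hU z hz
  have ht : Filter.Tendsto (fun r : ℝ => r ^ (2 * s) * (5 + 2 * ‖z.2.2‖))
      (nhdsWithin (0 : ℝ) (Ioi 0)) (nhds 0) := by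
    have h1 : Continuous (fun r : ℝ => r ^ (2 * s) * (5 + 2 * ‖z.2.2‖)) :=
      (Real.continuous_rpow_const (by linarith [hs.1])).mul continuous_const
    have h2 := (h1.tendsto 0).mono_left (nhdsWithin_le_nhds (s := Ioi (0 : ℝ)))
    rwa [Real.zero_rpow (by linarith [hs.1]), zero_mul] at h2
  have e1 := ht.eventually (gt_mem_nhds hδ)
  have e2 : ∀ᶠ r in nhdsWithin (0 : ℝ) (Ioi 0), r < min 1 (δ / 2) :=
    nhdsWithin_le_nhds (gt_mem_nhds (by positivity))
  filter_upwards [e1, e2, self_mem_nhdsWithin] with r h1 h2 hr c hn w hw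
  have hr : 0 < r := hr
  have hr1 : r < 1 := lt_of_lt_of_le h2 (min_le_left _ _)
  have hr2 : r < δ / 2 := lt_of_lt_of_le h2 (min_le_right _ _)
  apply hb
  obtain ⟨hw1, hw2, hw3, hw4⟩ := hw
  obtain ⟨hn1, hn2, hn3⟩ := hn
  rw [ink_rpow_split s r hr] at hw4 hn3
  have hA0 : 0 < r ^ (2 * s) := by positivity
  set A := r ^ (2 * s)
  rw [abs_le] at hn1
  have h3 : |w.1 - z.1| ≤ 2 * A := by rw [abs_le]; constructor <;> linarith
  have hv : 0 ≤ ‖z.2.2‖ := norm_nonneg _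
  have hv' : 0 ≤ A * ‖z.2.2‖ := by positivity
  rw [mem_ball, Prod.dist_eq, Prod.dist_eq]
  refine max_lt ?_ (max_lt ?_ ?_)
  · rw [Real.dist_eq]
    linarith
  · rw [dist_eq_norm]
    have e : w.2.1 - z.2.1 = (w.2.1 - c.2.1 - (w.1 - c.1) • c.2.2) -
      (z.2.1 - c.2.1 - (z.1 - c.1) • c.2.2) + (w.1 - z.1) • c.2.2 := by module
    rw [e]
    have h4 := norm_add_le ((w.2.1 - c.2.1 - (w.1 - c.1) • c.2.2) -
      (z.2.1 - c.2.1 - (z.1 - c.1) • c.2.2)) ((w.1 - z.1) • c.2.2)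
    have h5 := norm_sub_le (w.2.1 - c.2.1 - (w.1 - c.1) • c.2.2)
      (z.2.1 - c.2.1 - (z.1 - c.1) • c.2.2)
    have h6 : ‖c.2.2‖ ≤ ‖z.2.2‖ + 1 := by
      rw [dist_comm, dist_eq_norm] at hn2
      have := norm_sub_norm_le c.2.2 z.2.2
      linarith
    have h7 : ‖(w.1 - z.1) • c.2.2‖ ≤ 2 * A * (‖z.2.2‖ + 1) := by
      rw [norm_smul, Real.norm_eq_abs]
      gcongr
    have h8 : r * A ≤ 1 * A := by gcongr
    linarith
  · have := dist_triangle_right w.2.2 z.2.2 c.2.2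
    linarith

lemma ink_compl_ge (d : ℕ) (hd : 1 ≤ d) (s : ℝ) (E : Set (Phase d)) (hE : MeasurableSet E) (μ : ℝ)
    (hμ : μ ∈ Ioo (0 : ℝ) 1) (c : Phase d) (r : ℝ) (hr : 0 < r)
    (h : volume (kinCyl d s c r ∩ E) ≤ ENNReal.ofReal (1 - μ) * volume (kinCyl d s c r)) :
    ENNReal.ofReal μ * volume (kinCyl d s c r) ≤ volume (kinCyl d s c r \ E) := by
  have h1 := measure_inter_add_sdiff (μ := (volume : Measure (Phase d))) (kinCyl d s c r) hE
  have h2 : ENNReal.ofReal (1 - μ) + ENNReal.ofReal μ = 1 := by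
    rw [← ENNReal.ofReal_add (by linarith [hμ.2]) hμ.1.le]; simp
  have hfin : ENNReal.ofReal (1 - μ) * volume (kinCyl d s c r) ≠ ⊤ :=
    (ENNReal.mul_lt_top ENNReal.ofReal_lt_top (ink_cyl_vol_lt d hd s c r hr)).ne
  have h3 : ENNReal.ofReal (1 - μ) * volume (kinCyl d s c r) + ENNReal.ofReal μ *
      volume (kinCyl d s c r) ≤ ENNReal.ofReal (1 - μ) * volume (kinCyl d s c r) +
      volume (kinCyl d s c r \ E) := by
    rw [← add_mul, h2, one_mul]
    conv_lhs => rw [← h1]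
    gcongr
  exact (ENNReal.add_le_add_iff_left hfin).1 h3

lemma ink_density (d : ℕ) (hd : 1 ≤ d) (s : ℝ) (hs : s ∈ Ioo (0 : ℝ) 1) (E : Set (Phase d))
    (hE : MeasurableSet E) (hEf : volume E ≠ ⊤) (μ : ℝ) (hμ : μ ∈ Ioo (0 : ℝ) 1)
    (c : Phase d → ℝ → Phase d)
    (hc : ∀ z ∈ E, ∀ᶠ r in nhdsWithin (0 : ℝ) (Ioi 0), ink_near d s z (c z r) r) :
    volume {z | z ∈ E ∧ ¬ ∀ᶠ r in nhdsWithin (0 : ℝ) (Ioi 0),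
      ENNReal.ofReal (1 - μ) * volume (kinCyl d s (c z r) r) ≤
        volume (kinCyl d s (c z r) r ∩ E)} = 0 := by
  set D := {z | z ∈ E ∧ ¬ ∀ᶠ r in nhdsWithin (0 : ℝ) (Ioi 0),
      ENNReal.ofReal (1 - μ) * volume (kinCyl d s (c z r) r) ≤
        volume (kinCyl d s (c z r) r ∩ E)} with hD
  have hCpos : 0 < ink_C d := by linarith [ink_C_ge d]
  have key : ∀ ε : ENNReal, ε ≠ 0 → ENNReal.ofReal μ * volume D ≤ ENNReal.ofReal (ink_C d) * ε := by
    intro ε hε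
    obtain ⟨U, hUE, hUo, -, hUm⟩ := hE.exists_isOpen_sdiff_lt hEf hε
    have hex : ∀ z ∈ D, ∃ r, 0 < r ∧ r ≤ 1 ∧ ink_near d s z (c z r) r ∧ kinCyl d s (c z r) r ⊆ U ∧
        volume (kinCyl d s (c z r) r ∩ E) ≤
          ENNReal.ofReal (1 - μ) * volume (kinCyl d s (c z r) r) := by
      rintro z ⟨hzE, hz⟩
      rw [Filter.not_eventually] at hz
      have e2 : ∀ᶠ r in nhdsWithin (0 : ℝ) (Ioi 0), r < 1 :=
        nhdsWithin_le_nhds (gt_mem_nhds (by positivity))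
      obtain ⟨r, h1, h2, h3, h4, h5⟩ := (hz.and_eventually ((hc z hzE).and
        ((ink_shrink d s hs U hUo z (hUE hzE)).and (e2.and self_mem_nhdsWithin)))).exists
      exact ⟨r, h5, h4.le, h2, h3 _ h2, (not_le.1 h1).le⟩
    choose! r hr0 hr1 hrn hrU hrE using hex
    obtain ⟨u, huD, huc, hu⟩ := ink_vitali d hd s hs D (U \ E) (MeasurableSet.diff hUo.measurableSet hE)
      (ENNReal.ofReal μ) (fun z => c z (r z)) r hr0 hr1 hrn (by
        intro z hz
        refine (ink_compl_ge d hd s E hE μ hμ _ _ (hr0 z hz) (hrE z hz)).trans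
          (measure_mono ?_)
        intro w hw
        exact ⟨hw.1, hrU z hz hw.1, hw.2⟩)
    refine hu.trans ?_
    gcongr
    exact (measure_mono inter_subset_right).trans hUm.le
  have h0 : ENNReal.ofReal μ * volume D = 0 := by
    by_contra hne
    have hne' : ENNReal.ofReal (ink_C d) ≠ 0 := (ENNReal.ofReal_pos.2 hCpos).ne'
    by_cases htop : ENNReal.ofReal μ * volume D = ⊤
    · have := key 1 one_ne_zero
      rw [htop, mul_one, top_le_iff] at this
      exact ENNReal.ofReal_ne_top this
    · have h := key (ENNReal.ofReal μ * volume D / 2 / ENNReal.ofReal (ink_C d))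
        (ENNReal.div_pos (ENNReal.half_pos hne).ne' ENNReal.ofReal_ne_top).ne'
      rw [ENNReal.mul_div_cancel hne' ENNReal.ofReal_ne_top] at h
      exact absurd (ENNReal.half_lt_self hne htop) (not_lt.2 h)
  rcases mul_eq_zero.1 h0 with h | h
  · exact absurd h (ENNReal.ofReal_pos.2 hμ.1).ne'
  · exact h

lemma ink_sign (f : ℝ → ℝ) (hf : Continuous f) (ρ : ℝ) (h : f ρ ≠ 0) :
    ∀ᶠ r in nhds ρ, (0 < f r ↔ 0 < f ρ) := by
  rcases lt_or_gt_of_ne h with h | h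
  · filter_upwards [hf.continuousAt.eventually (gt_mem_nhds h)] with r hr
    exact ⟨fun h1 => absurd h1 (not_lt.2 hr.le), fun h1 => absurd h1 (not_lt.2 h.le)⟩
  · filter_upwards [hf.continuousAt.eventually (lt_mem_nhds h)] with r hr
    exact ⟨fun _ => h, fun _ => hr⟩

lemma ink_cont (d : ℕ) (hd : 1 ≤ d) (s : ℝ) (hs : s ∈ Ioo (0 : ℝ) 1) (S : Set (Phase d))
    (hS : MeasurableSet S) (hSf : volume S ≠ ⊤) (c : ℝ → Phase d) (hc : Continuous c) :
    Continuous (fun r => volume (kinCyl d s (c r) r ∩ S)) := by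
  have : Nonempty (Fin d) := ⟨⟨0, hd⟩⟩
  rw [continuous_iff_continuousAt]
  intro ρ
  have hp1 : Continuous (fun r : ℝ => r ^ (2 * s)) :=
    Real.continuous_rpow_const (by linarith [hs.1])
  have hp2 : Continuous (fun r : ℝ => r ^ (1 + 2 * s)) :=
    Real.continuous_rpow_const (by linarith [hs.1])
  refine tendsto_measure_of_ae_tendsto_indicator (nhds ρ) ((ink_cyl_meas d s _ _).inter hS)
    (fun r => (ink_cyl_meas d s _ _).inter hS) hS hSf
    (Filter.Eventually.of_forall fun r => inter_subset_right) ?_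
  have hmp := ink_str_mp d (c ρ)
  have n1 : ∀ a : ℝ, ∀ᵐ z : Phase d, z.1 ≠ a := by
    intro a
    have h : volume (ink_str d (c ρ) ⁻¹' ({a} ×ˢ univ)) = 0 := by
      rw [hmp.measure_preimage ((measurableSet_singleton a).prod
        MeasurableSet.univ).nullMeasurableSet, Measure.volume_eq_prod, Measure.prod_prod]
      simp
    rw [ae_iff]
    refine measure_mono_null ?_ h
    intro z hz
    simp only [ne_eq, not_not, mem_ofPred_eq] at hz
    simp [ink_str, hz]
  have n2 : ∀ᵐ z : Phase d, dist z.2.2 (c ρ).2.2 ≠ ρ := by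
    have h : volume (ink_str d (c ρ) ⁻¹' (univ ×ˢ (univ ×ˢ sphere 0 ρ))) = 0 := by
      rw [hmp.measure_preimage (MeasurableSet.univ.prod (MeasurableSet.univ.prod
        isClosed_sphere.measurableSet)).nullMeasurableSet, Measure.volume_eq_prod, Measure.prod_prod,
        Measure.volume_eq_prod, Measure.prod_prod, Measure.addHaar_sphere]
      simp
    rw [ae_iff]
    refine measure_mono_null ?_ h
    intro z hz
    simp only [ne_eq, not_not, mem_ofPred_eq, dist_eq_norm] at hz
    simp [ink_str, ← sub_eq_add_neg, hz]
  have n3 : ∀ᵐ z : Phase d, ‖z.2.1 - (c ρ).2.1 - (z.1 - (c ρ).1) • (c ρ).2.2‖ ≠ ρ ^ (1 + 2 * s) := by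
    have h : volume (ink_str d (c ρ) ⁻¹' (univ ×ˢ (sphere 0 (ρ ^ (1 + 2 * s)) ×ˢ univ))) = 0 := by
      rw [hmp.measure_preimage (MeasurableSet.univ.prod (isClosed_sphere.measurableSet.prod
        MeasurableSet.univ)).nullMeasurableSet, Measure.volume_eq_prod, Measure.prod_prod,
        Measure.volume_eq_prod, Measure.prod_prod, Measure.addHaar_sphere]
      simp
    rw [ae_iff]
    refine measure_mono_null ?_ h
    intro z hz
    simp only [ne_eq, not_not, mem_ofPred_eq] at hz
    have e : z.2.1 + (-(c ρ).2.1 - (z.1 - (c ρ).1) • (c ρ).2.2) =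
      z.2.1 - (c ρ).2.1 - (z.1 - (c ρ).1) • (c ρ).2.2 := by abel
    simp [ink_str, e, hz]
  filter_upwards [n1 ((c ρ).1 - ρ ^ (2 * s)), n1 ((c ρ).1), n2, n3] with z h1 h2 h3 h4
  have e1 := ink_sign (fun r => z.1 - ((c r).1 - r ^ (2 * s))) (by fun_prop) ρ (sub_ne_zero.2 h1)
  have e2 := ink_sign (fun r => z.1 - (c r).1) (by fun_prop) ρ (sub_ne_zero.2 h2)
  have e3 := ink_sign (fun r => r - dist z.2.2 (c r).2.2) (by fun_prop) ρ (sub_ne_zero.2 h3.symm)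
  have e4 := ink_sign (fun r => r ^ (1 + 2 * s) -
    ‖z.2.1 - (c r).2.1 - (z.1 - (c r).1) • (c r).2.2‖) (by fun_prop) ρ (sub_ne_zero.2 h4.symm)
  filter_upwards [e1, e2, e3, e4] with r e1 e2 e3 e4
  simp only [sub_pos] at e1 e2 e3 e4
  have e2' := not_congr e2
  simp only [not_lt] at e2'
  simp only [kinCyl, mem_inter_iff, mem_ofPred_eq]
  rw [e1, e2', e3, e4]

lemma ink_mem_unit (d : ℕ) (s : ℝ) (z : Phase d) :
    z ∈ unitCyl d s ↔ -1 < z.1 ∧ z.1 ≤ 0 ∧ ‖z.2.2‖ < 1 ∧ ‖z.2.1‖ < 1 := by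
  simp [unitCyl, kinCyl]

/-- Trajectory label of a point. -/
def ink_lab (d : ℕ) (z : Phase d) : EuclideanSpace ℝ (Fin d) × EuclideanSpace ℝ (Fin d) :=
  (z.2.1 - z.1 • z.2.2, z.2.2)

lemma ink_traj_lab (d : ℕ) (z : Phase d) (t : ℝ) :
    ink_traj d (t, ink_lab d z) = (t, z.2.1 + (t - z.1) • z.2.2, z.2.2) := by
  simp only [ink_traj, ink_lab]
  congr 2
  module

lemma ink_chord (d : ℕ) (s : ℝ) (z : Phase d) (hz : z ∈ unitCyl d s) :
    ∃ p q : ℝ, p ≤ z.1 ∧ z.1 ≤ q ∧ p < q ∧ q - p ≤ 1 ∧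
      (∀ t ∈ Icc p q, ink_traj d (t, ink_lab d z) ∈ unitCyl d s) ∧
      volume (ink_fib d (unitCyl d s) (ink_lab d z)) ≤ ENNReal.ofReal (2 * (q - p)) := by
  set I := ink_fib d (unitCyl d s) (ink_lab d z) with hI
  have hmem : ∀ t, t ∈ I ↔ -1 < t ∧ t ≤ 0 ∧ ‖z.2.1 + (t - z.1) • z.2.2‖ < 1 := by
    intro t
    have := (ink_mem_unit d s z).1 hz
    rw [hI, ink_fib, mem_ofPred_eq, ink_traj_lab, ink_mem_unit]
    simp [this.2.2.1]
  have hconv : ∀ p ∈ I, ∀ q ∈ I, ∀ t ∈ Icc p q, t ∈ I := by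
    intro p hp q hq t ht
    rw [hmem] at hp hq ⊢
    refine ⟨by linarith [ht.1], by linarith [ht.2], ?_⟩
    rcases eq_or_lt_of_le (ht.1.trans ht.2) with h | h
    · have : t = p := le_antisymm (by rw [h]; exact ht.2) ht.1
      rw [this]; exact hp.2.2
    · have hL : 0 < q - p := by linarith
      have e : z.2.1 + (t - z.1) • z.2.2 = ((q - t) / (q - p)) • (z.2.1 + (p - z.1) • z.2.2) +
          ((t - p) / (q - p)) • (z.2.1 + (q - z.1) • z.2.2) := by
        have h1 : (q - t) / (q - p) = 1 - (t - p) / (q - p) := by field_simp; ring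
        have h2 : t = p + (t - p) / (q - p) * (q - p) := by field_simp; ring
        rw [h1]
        set a := (t - p) / (q - p)
        rw [h2]
        module
      have ha : 0 ≤ (q - t) / (q - p) := div_nonneg (by linarith [ht.2]) hL.le
      have hb : 0 ≤ (t - p) / (q - p) := div_nonneg (by linarith [ht.1]) hL.le
      have hab : (q - t) / (q - p) + (t - p) / (q - p) = 1 := by field_simp; ring
      have := convex_ball (0 : EuclideanSpace ℝ (Fin d)) 1 (mem_ball_zero_iff.2 hp.2.2)
        (mem_ball_zero_iff.2 hq.2.2) ha hb hab
      rw [e]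
      exact mem_ball_zero_iff.1 this
  have hz1 : z.1 ∈ I := by
    have := (ink_mem_unit d s z).1 hz
    rw [hmem]; simp [this]
  have hIpos : ∃ p ∈ I, p < z.1 := by
    have h1 : ∀ᶠ t in nhds z.1, -1 < t ∧ ‖z.2.1 + (t - z.1) • z.2.2‖ < 1 := by
      have hc : Continuous (fun t : ℝ => ‖z.2.1 + (t - z.1) • z.2.2‖) := by fun_prop
      exact (lt_mem_nhds ((hmem _).1 hz1).1).and
        (hc.continuousAt.eventually (gt_mem_nhds ((hmem _).1 hz1).2.2))
    have h2 : ∀ᶠ t in nhdsWithin z.1 (Iio z.1), -1 < t ∧ ‖z.2.1 + (t - z.1) • z.2.2‖ < 1 :=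
      nhdsWithin_le_nhds h1
    obtain ⟨t, ht1, ht2⟩ := (h2.and self_mem_nhdsWithin).exists
    have ht2 : t < z.1 := ht2
    exact ⟨t, (hmem t).2 ⟨ht1.1, ht2.le.trans ((hmem _).1 hz1).2.1, ht1.2⟩, ht2⟩
  obtain ⟨p₀, hp₀, hp₀z⟩ := hIpos
  have hle : ∃ a ∈ I, ∃ b ∈ I, a < b ∧ volume I ≤ ENNReal.ofReal (2 * (b - a)) := by
    by_contra hcon
    push Not at hcon
    have hd0 : volume I ≠ 0 := by
      have := hcon p₀ hp₀ z.1 hz1 hp₀z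
      exact (lt_of_le_of_lt (zero_le) this).ne'
    have hdt : volume I ≠ ⊤ := by
      have : I ⊆ Icc (-1) 0 := fun t ht => ⟨((hmem t).1 ht).1.le, ((hmem t).1 ht).2.1⟩
      exact (lt_of_le_of_lt (measure_mono this) (by simp)).ne
    have h1 : Metric.ediam I ≤ volume I / 2 := by
      refine Metric.ediam_le ?_
      have aux : ∀ a ∈ I, ∀ b ∈ I, a < b → edist a b ≤ volume I / 2 := by
        intro a ha b hb hab
        have := hcon a ha b hb hab
        rw [edist_dist, dist_comm, Real.dist_eq, abs_of_pos (sub_pos.2 hab),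
          ENNReal.le_div_iff_mul_le (by simp) (by simp)]
        rw [ENNReal.ofReal_mul (by norm_num)] at this
        rw [mul_comm]
        simpa using this.le
      intro a ha b hb
      rcases lt_trichotomy a b with h | h | h
      · exact aux a ha b hb h
      · simp [h]
      · rw [edist_comm]; exact aux b hb a ha h
    have h2 := (Real.volume_le_diam I).trans h1
    exact absurd (ENNReal.half_lt_self hd0 hdt) (not_lt.2 h2)
  obtain ⟨a, ha, b, hb, hab, hvol⟩ := hle
  have hp : min a z.1 ∈ I := by rcases min_choice a z.1 with h | h <;> rw [h] <;> assumption
  have hq : max b z.1 ∈ I := by rcases max_choice b z.1 with h | h <;> rw [h] <;> assumption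
  refine ⟨min a z.1, max b z.1, min_le_right _ _, le_max_right _ _,
    lt_of_le_of_lt (min_le_left _ _) (lt_of_lt_of_le hab (le_max_left _ _)), ?_, ?_, ?_⟩
  · have h1 := (hmem _).1 hp
    have h2 := (hmem _).1 hq
    linarith
  · intro t ht
    exact hconv _ hp _ hq t ht
  · refine hvol.trans (ENNReal.ofReal_le_ofReal ?_)
    have := min_le_left a z.1
    have := le_max_left b z.1
    linarith

lemma ink_path (d : ℕ) (s : ℝ) (hs : s ∈ Ioo (0 : ℝ) 1) (z : Phase d) (hz : z ∈ unitCyl d s) :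
    ∃ (L : ℝ) (c : ℝ → Phase d), 0 < L ∧ L ≤ 1 ∧ Continuous c ∧
      volume (ink_fib d (unitCyl d s) (ink_lab d z)) ≤ ENNReal.ofReal (2 * L) ∧
      ∀ r, 0 < r → r ^ (2 * s) ≤ L / 4 → r ≤ 1 ∧ ink_near d s z (c r) r ∧
        kinCyl d s (c r) r ⊆ unitCyl d s := by
  obtain ⟨p, q, hp, hq, hpq, hpq1, hin, hvol⟩ := ink_chord d s z hz
  have hzu := (ink_mem_unit d s z).1 hz
  have hL : 0 < q - p := by linarith
  set θ := (q - z.1) / (q - p) with hθ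
  have hθ0 : 0 ≤ θ := div_nonneg (by linarith) hL.le
  have hθ1 : θ ≤ 1 := by rw [hθ, div_le_one hL]; linarith
  have hθq : θ * (q - p) = q - z.1 := by rw [hθ]; field_simp
  have hp1 : Continuous (fun r : ℝ => r ^ (2 * s)) :=
    Real.continuous_rpow_const (by linarith [hs.1])
  have hp2 : Continuous (fun r : ℝ => r ^ (1 + 2 * s)) :=
    Real.continuous_rpow_const (by linarith [hs.1])
  refine ⟨q - p, fun r => (z.1 + θ * r ^ (2 * s),
    (1 - 2 * r ^ (1 + 2 * s)) • z.2.1 + (θ * r ^ (2 * s) * (1 - r)) • z.2.2, (1 - r) • z.2.2),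
    hL, hpq1, by fun_prop, hvol, ?_⟩
  intro r hr hrL
  have hr2 : r ≤ 1 / 2 := by
    by_contra hcon
    push Not at hcon
    have h1 : (1 / 2 : ℝ) ^ (2 * s) < r ^ (2 * s) :=
      Real.rpow_lt_rpow (by norm_num) hcon (by linarith [hs.1])
    have h2 : (1 / 2 : ℝ) ^ (2 : ℝ) ≤ (1 / 2 : ℝ) ^ (2 * s) :=
      Real.rpow_le_rpow_of_exponent_ge (by norm_num) (by norm_num) (by linarith [hs.2])
    have h3 : (1 / 2 : ℝ) ^ (2 : ℝ) = 1 / 4 := by norm_num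
    linarith
  have hA : 0 < r ^ (2 * s) := by positivity
  rw [ink_near]
  simp only [kinCyl]
  rw [ink_rpow_split s r hr]
  set A := r ^ (2 * s)
  have hrA : 0 < r * A := by positivity
  have hA1 : A ≤ 1 / 4 := by linarith
  have hrA1 : r * A ≤ r * (1 / 4) := by gcongr
  have hθA : θ * A ≤ 1 * A := by gcongr
  have hθA0 : 0 ≤ θ * A := by positivity
  refine ⟨by linarith, ⟨?_, ?_, ?_⟩, ?_⟩
  · rw [abs_le]; constructor <;> linarith
  · rw [dist_eq_norm, show z.2.2 - (1 - r) • z.2.2 = r • z.2.2 by module, norm_smul,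
      Real.norm_of_nonneg hr.le]
    nlinarith [hzu.2.2.1]
  · rw [show z.2.1 - ((1 - 2 * (r * A)) • z.2.1 + (θ * A * (1 - r)) • z.2.2) -
      (z.1 - (z.1 + θ * A)) • (1 - r) • z.2.2 = (2 * (r * A)) • z.2.1 by module, norm_smul,
      Real.norm_of_nonneg (by positivity)]
    nlinarith [hzu.2.2.2]
  · rintro ⟨t, x, v⟩ ⟨h1, h2, h3, h4⟩
    simp only at h1 h2 h3 h4
    have htI : t ∈ Icc p q := by
      have h5 : A ≤ q - p := by linarith
      constructor
      · have h6 : (1 - θ) * A ≤ (1 - θ) * (q - p) := by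
          apply mul_le_mul_of_nonneg_left h5; linarith
        nlinarith
      · have h6 : θ * A ≤ θ * (q - p) := by gcongr
        linarith
    have ht := hin t htI
    rw [ink_traj_lab, ink_mem_unit] at ht
    simp only at ht
    rw [ink_mem_unit]
    simp only
    refine ⟨ht.1, ht.2.1, ?_, ?_⟩
    · have h5 : ‖v‖ ≤ dist v ((1 - r) • z.2.2) + ‖(1 - r) • z.2.2‖ := by
        rw [dist_eq_norm]
        have := norm_add_le (v - (1 - r) • z.2.2) ((1 - r) • z.2.2)
        rwa [sub_add_cancel] at this
      rw [norm_smul, Real.norm_of_nonneg (by linarith)] at h5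
      have : (1 - r) * ‖z.2.2‖ ≤ (1 - r) * 1 :=
        mul_le_mul_of_nonneg_left hzu.2.2.1.le (by linarith)
      linarith
    · have e : x = (x - ((1 - 2 * (r * A)) • z.2.1 + (θ * A * (1 - r)) • z.2.2) -
          (t - (z.1 + θ * A)) • (1 - r) • z.2.2) +
          ((1 - 2 * (r * A)) • (z.2.1 + (t - z.1) • z.2.2) +
            ((t - z.1) * (2 * (r * A) - r)) • z.2.2) := by module
      have h5 : ‖(1 - 2 * (r * A)) • (z.2.1 + (t - z.1) • z.2.2)‖ ≤ (1 - 2 * (r * A)) * 1 := by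
        rw [norm_smul, Real.norm_of_nonneg (by linarith)]
        exact mul_le_mul_of_nonneg_left ht.2.2.2.le (by linarith)
      have h6 : ‖((t - z.1) * (2 * (r * A) - r)) • z.2.2‖ ≤ A * r * 1 := by
        rw [norm_smul, Real.norm_eq_abs, abs_mul]
        have a1 : |t - z.1| ≤ A := by rw [abs_le]; constructor <;> linarith
        have a2 : |2 * (r * A) - r| ≤ r := by rw [abs_le]; constructor <;> linarith
        have a3 : ‖z.2.2‖ ≤ 1 := hzu.2.2.1.le
        gcongr
      have h7 := norm_add_le (x - ((1 - 2 * (r * A)) • z.2.1 + (θ * A * (1 - r)) • z.2.2) -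
          (t - (z.1 + θ * A)) • (1 - r) • z.2.2)
          ((1 - 2 * (r * A)) • (z.2.1 + (t - z.1) • z.2.2) +
            ((t - z.1) * (2 * (r * A) - r)) • z.2.2)
      have h8 := norm_add_le ((1 - 2 * (r * A)) • (z.2.1 + (t - z.1) • z.2.2))
            (((t - z.1) * (2 * (r * A) - r)) • z.2.2)
      rw [← e] at h7
      linarith

lemma ink_stack_mem (d : ℕ) (s m : ℝ) (z c : Phase d) (r κ : ℝ) (hr : 0 < r) (hκ : κ ≤ m)
    (t : ℝ) (ht : t ∈ Ioc c.1 (c.1 + κ * r ^ (2 * s)))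
    (h1 : |t - z.1| ≤ (κ + 1) * r ^ (2 * s)) (h2 : dist z.2.2 c.2.2 < r)
    (h3 : ‖z.2.1 - c.2.1 - (z.1 - c.1) • c.2.2‖ < (m - κ + 1) * r ^ (1 + 2 * s)) :
    ink_traj d (t, ink_lab d z) ∈ kinCylStack d s m c r := by
  rw [ink_traj_lab]
  have hA : 0 < r ^ (2 * s) := by positivity
  rw [ink_rpow_split s r hr] at h3
  simp only [kinCylStack, mem_ofPred_eq]
  rw [ink_rpow_split s r hr]
  set A := r ^ (2 * s)
  refine ⟨by linarith [ht.1], ?_, h2, ?_⟩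
  · have : κ * A ≤ m * A := by gcongr
    linarith [ht.2]
  · rw [show z.2.1 + (t - z.1) • z.2.2 - c.2.1 - (t - c.1) • c.2.2 =
      (z.2.1 - c.2.1 - (z.1 - c.1) • c.2.2) + (t - z.1) • (z.2.2 - c.2.2) by module]
    refine (norm_add_le _ _).trans_lt ?_
    rw [norm_smul, Real.norm_eq_abs, ← dist_eq_norm z.2.2]
    have : |t - z.1| * dist z.2.2 c.2.2 ≤ ((κ + 1) * A) * r := by
      gcongr
      exact (abs_nonneg _).trans h1
    nlinarith

lemma ink_stack_near (d : ℕ) (s m : ℝ) (z c : Phase d) (r : ℝ) (hr : 0 < r) (hm : 1 ≤ m)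
    (hn : ink_near d s z c r) (F : Set (Phase d)) (hF : kinCylStack d s m c r ⊆ F) :
    ENNReal.ofReal ((m - 1) * r ^ (2 * s)) ≤ volume (ink_fib d F (ink_lab d z)) := by
  have hsub : Ioc c.1 (c.1 + (m - 1) * r ^ (2 * s)) ⊆ ink_fib d F (ink_lab d z) := by
    intro t ht
    apply hF
    have h1 := abs_le.1 hn.1
    refine ink_stack_mem d s m z c r (m - 1) hr (by linarith) t ht ?_ hn.2.1 ?_
    · have hA : 0 < r ^ (2 * s) := by positivity
      have : 0 ≤ (m - 1) * r ^ (2 * s) := mul_nonneg (by linarith) hA.le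
      rw [abs_le]; constructor <;> linarith [ht.1, ht.2]
    · rw [show m - (m - 1) + 1 = 2 by ring]; exact hn.2.2
  refine le_trans ?_ (measure_mono hsub)
  rw [Real.volume_Ioc, add_sub_cancel_left]

lemma ink_stack_in (d : ℕ) (s m : ℝ) (z c : Phase d) (r : ℝ) (hr : 0 < r) (hm : 1 ≤ m)
    (hz : z ∈ kinCyl d s c r) (F : Set (Phase d)) (hF : kinCylStack d s m c r ⊆ F) :
    Ioc c.1 (c.1 + m * r ^ (2 * s)) ⊆ ink_fib d F (ink_lab d z) := by
  intro t ht
  apply hF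
  obtain ⟨h1, h2, h3, h4⟩ := hz
  refine ink_stack_mem d s m z c r m hr le_rfl t ht ?_ h3 ?_
  · have hA : 0 < r ^ (2 * s) := by positivity
    have : 0 ≤ m * r ^ (2 * s) := mul_nonneg (by linarith) hA.le
    rw [abs_le]; constructor <;> linarith [ht.1, ht.2]
  · simpa using h4

lemma ink_lab_traj (d : ℕ) (t : ℝ) (w : EuclideanSpace ℝ (Fin d) × EuclideanSpace ℝ (Fin d)) :
    ink_lab d (ink_traj d (t, w)) = w := by
  simp [ink_lab, ink_traj]

/-- Points covered by a cylinder whose stack lies in `F` satisfy the fiberwise estimate. -/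
lemma ink_fib_le (d : ℕ) (s m : ℝ) (hm : 1 ≤ m) (G F : Set (Phase d))
    (hG : ∀ z ∈ G, ∃ c r, 0 < r ∧ z ∈ kinCyl d s c r ∧ kinCylStack d s m c r ⊆ F)
    (w : EuclideanSpace ℝ (Fin d) × EuclideanSpace ℝ (Fin d)) :
    volume (ink_fib d G w) ≤ ENNReal.ofReal ((m + 1) / m) * volume (ink_fib d F w) := by
  refine ink_1d m (by linarith) _ _ ?_
  intro t ht
  obtain ⟨c, r, hr, hz, hF⟩ := hG _ ht
  have := ink_stack_in d s m _ c r hr hm hz F hF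
  rw [ink_lab_traj] at this
  exact ⟨c.1, r ^ (2 * s), by positivity, hz.1, hz.2.1, this⟩

lemma ink_self (d : ℕ) (s : ℝ) (z : Phase d) (r : ℝ) (hr : 0 < r) :
    z ∈ kinCyl d s z r ∧ ink_near d s z z r := by
  have hA : 0 < r ^ (2 * s) := by positivity
  have hB : 0 < r ^ (1 + 2 * s) := by positivity
  constructor
  · simp [kinCyl, hr, hA, hB]
  · simp [ink_near, hr, hA.le, hB]

lemma ink_self_sub (d : ℕ) (s : ℝ) (hs : s ∈ Ioo (0 : ℝ) 1) (z : Phase d) (hz : z ∈ unitCyl d s) :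
    ∀ᶠ r in nhdsWithin (0 : ℝ) (Ioi 0), kinCyl d s z r ⊆ unitCyl d s := by
  have hzu := (ink_mem_unit d s z).1 hz
  have hU : IsOpen {w : Phase d | -1 < w.1 ∧ ‖w.2.2‖ < 1 ∧ ‖w.2.1‖ < 1} := by
    have e1 : IsOpen {w : Phase d | -1 < w.1} := isOpen_lt continuous_const (by fun_prop)
    have e2 : IsOpen {w : Phase d | ‖w.2.2‖ < 1} := isOpen_lt (by fun_prop) continuous_const
    have e3 : IsOpen {w : Phase d | ‖w.2.1‖ < 1} := isOpen_lt (by fun_prop) continuous_const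
    exact e1.inter (e2.inter e3)
  filter_upwards [ink_shrink d s hs _ hU z ⟨hzu.1, hzu.2.2.1, hzu.2.2.2⟩, self_mem_nhdsWithin]
    with r h1 hr w hw
  obtain ⟨a, b, c⟩ := h1 z (ink_self d s z r hr).2 hw
  exact (ink_mem_unit d s w).2 ⟨a, hw.2.1.trans hzu.2.1, b, c⟩

lemma ink_unit_lt (d : ℕ) (hd : 1 ≤ d) (s : ℝ) : volume (unitCyl d s) < ⊤ :=
  ink_cyl_vol_lt d hd s 0 1 one_pos

/-- On trajectories where `F` is short, the density crosses the level `1 - μ`. -/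
lemma ink_cross (d : ℕ) (hd : 1 ≤ d) (s : ℝ) (hs : s ∈ Ioo (0 : ℝ) 1) (μ m : ℝ)
    (hμ : μ ∈ Ioo (0 : ℝ) 1) (hm : 17 ≤ m) (E F : Set (Phase d)) (hE : MeasurableSet E)
    (hEQ : E ⊆ unitCyl d s)
    (hst : ∀ (z₀ : Phase d) (r : ℝ), 0 < r → kinCyl d s z₀ r ⊆ unitCyl d s →
          ENNReal.ofReal (1 - μ) * volume (kinCyl d s z₀ r) ≤
            volume (kinCyl d s z₀ r ∩ E) → kinCylStack d s m z₀ r ⊆ F)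
    (z : Phase d) (L : ℝ) (c : ℝ → Phase d) (hL : 0 < L) (hc : Continuous c)
    (hvol : volume (ink_fib d (unitCyl d s) (ink_lab d z)) ≤ ENNReal.ofReal (2 * L))
    (hcr : ∀ r, 0 < r → r ^ (2 * s) ≤ L / 4 → r ≤ 1 ∧ ink_near d s z (c r) r ∧
        kinCyl d s (c r) r ⊆ unitCyl d s)
    (hdens : ∀ᶠ r in nhdsWithin (0 : ℝ) (Ioi 0),
      ENNReal.ofReal (1 - μ) * volume (kinCyl d s (c r) r) ≤ volume (kinCyl d s (c r) r ∩ E))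
    (hB : ¬ 2 * volume (ink_fib d (unitCyl d s) (ink_lab d z)) ≤ volume (ink_fib d F (ink_lab d z))) :
    ∃ r, 0 < r ∧ r ≤ 1 ∧ ink_near d s z (c r) r ∧ kinCyl d s (c r) r ⊆ unitCyl d s ∧
      volume (kinCyl d s (c r) r ∩ E) = ENNReal.ofReal (1 - μ) * volume (kinCyl d s (c r) r) := by
  have hut := (ink_unit_lt d hd s)
  have hEt : volume E ≠ ⊤ := (lt_of_le_of_lt (measure_mono hEQ) hut).ne
  have hs0 : 0 < 2 * s := by linarith [hs.1]
  set R := (L / 4) ^ (1 / (2 * s)) with hR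
  have hR0 : 0 < R := by positivity
  have hRp : R ^ (2 * s) = L / 4 := by
    rw [hR, ← Real.rpow_mul (by positivity), one_div, inv_mul_cancel₀ hs0.ne', Real.rpow_one]
  have hle : ∀ r, 0 < r → r ≤ R → r ^ (2 * s) ≤ L / 4 := by
    intro r h1 h2
    rw [← hRp]
    exact Real.rpow_le_rpow h1.le h2 hs0.le
  have hRlt : volume (kinCyl d s (c R) R ∩ E) <
      ENNReal.ofReal (1 - μ) * volume (kinCyl d s (c R) R) := by
    by_contra hcon
    rw [not_lt] at hcon
    obtain ⟨h1, h2, h3⟩ := hcr R hR0 hRp.le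
    have h4 := hst _ R hR0 h3 hcon
    have h5 := ink_stack_near d s m z (c R) R hR0 (by linarith) h2 F h4
    apply hB
    refine le_trans ?_ h5
    calc 2 * volume (ink_fib d (unitCyl d s) (ink_lab d z)) ≤ 2 * ENNReal.ofReal (2 * L) := by gcongr
      _ = ENNReal.ofReal (2 * (2 * L)) := by
          rw [ENNReal.ofReal_mul (p := 2) (q := 2 * L) (by norm_num)]; simp
      _ ≤ _ := by
          apply ENNReal.ofReal_le_ofReal
          rw [hRp]
          nlinarith
  have e2 : ∀ᶠ r in nhdsWithin (0 : ℝ) (Ioi 0), r < R :=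
    nhdsWithin_le_nhds (gt_mem_nhds hR0)
  obtain ⟨r₁, hd1, hr1R, hr1⟩ := (hdens.and (e2.and self_mem_nhdsWithin)).exists
  have hr1 : 0 < r₁ := hr1
  set f : ℝ → ℝ := fun r => (volume (kinCyl d s (c r) r ∩ E)).toReal -
    (1 - μ) * (volume (kinCyl d s (c r) r ∩ unitCyl d s)).toReal with hf
  have hfin : ∀ (S : Set (Phase d)), volume S ≠ ⊤ → ∀ r, volume (kinCyl d s (c r) r ∩ S) ≠ ⊤ :=
    fun S hS r => (lt_of_le_of_lt (measure_mono inter_subset_right) hS.lt_top).ne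
  have hcont : Continuous f := by
    have c1 := ink_cont d hd s hs E hE hEt c hc
    have c2 := ink_cont d hd s hs (unitCyl d s) (ink_cyl_meas d s 0 1) hut.ne c hc
    have d1 : Continuous (fun r => (volume (kinCyl d s (c r) r ∩ E)).toReal) :=
      ENNReal.continuousOn_toReal.comp_continuous c1 (fun r => hfin E hEt r)
    have d2 : Continuous (fun r => (volume (kinCyl d s (c r) r ∩ unitCyl d s)).toReal) :=
      ENNReal.continuousOn_toReal.comp_continuous c2 (fun r => hfin _ hut.ne r)
    exact d1.sub (continuous_const.mul d2)
  have hμ1 : 0 ≤ 1 - μ := by linarith [hμ.2]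
  have hval : ∀ r, 0 < r → r ≤ R → f r = (volume (kinCyl d s (c r) r ∩ E)).toReal -
      (ENNReal.ofReal (1 - μ) * volume (kinCyl d s (c r) r)).toReal := by
    intro r h1 h2
    rw [hf]
    simp only
    rw [inter_eq_left.2 (hcr r h1 (hle r h1 h2)).2.2, ENNReal.toReal_mul, ENNReal.toReal_ofReal hμ1]
  have hmt : ∀ r, 0 < r → ENNReal.ofReal (1 - μ) * volume (kinCyl d s (c r) r) ≠ ⊤ := fun r hr =>
    (ENNReal.mul_lt_top ENNReal.ofReal_lt_top (ink_cyl_vol_lt d hd s _ r hr)).ne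
  have hf1 : 0 ≤ f r₁ := by
    rw [hval r₁ hr1 hr1R.le, sub_nonneg]
    exact ENNReal.toReal_mono (hfin E hEt r₁) hd1
  have hfR : f R ≤ 0 := by
    rw [hval R hR0 le_rfl, sub_nonpos]
    exact ENNReal.toReal_mono (hmt R hR0) hRlt.le
  obtain ⟨r, ⟨hra, hrb⟩, hr0⟩ := intermediate_value_Icc' hr1R.le hcont.continuousOn ⟨hfR, hf1⟩
  have hr : 0 < r := lt_of_lt_of_le hr1 hra
  obtain ⟨h1, h2, h3⟩ := hcr r hr (hle r hr hrb)
  refine ⟨r, hr, h1, h2, h3, ?_⟩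
  rw [hval r hr hrb, sub_eq_zero] at hr0
  exact (ENNReal.toReal_eq_toReal_iff' (hfin E hEt r) (hmt r hr)).1 hr0

lemma ink_large (d : ℕ) (hd : 1 ≤ d) (s : ℝ) (hs : s ∈ Ioo (0 : ℝ) 1) (μ m : ℝ)
    (hμ : μ ∈ Ioo (0 : ℝ) 1) (hm : 17 ≤ m) (E F : Set (Phase d)) (hE : MeasurableSet E)
    (hF : MeasurableSet F) (hEQ : E ⊆ unitCyl d s)
    (hst : ∀ (z₀ : Phase d) (r : ℝ), 0 < r → kinCyl d s z₀ r ⊆ unitCyl d s →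
          ENNReal.ofReal (1 - μ) * volume (kinCyl d s z₀ r) ≤
            volume (kinCyl d s z₀ r ∩ E) → kinCylStack d s m z₀ r ⊆ F) :
    ∃ e0 eb pe : ENNReal, ENNReal.ofReal μ * e0 ≤ ENNReal.ofReal (ink_C d) * pe ∧
      volume E ≤ e0 + eb ∧
      volume E + pe + eb ≤ ENNReal.ofReal ((m + 1) / m) * volume F := by
  have hut := (ink_unit_lt d hd s)
  have hEt : volume E ≠ ⊤ := (lt_of_le_of_lt (measure_mono hEQ) hut).ne
  have hQm : MeasurableSet (unitCyl d s) := ink_cyl_meas d s 0 1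
  choose! L c hL hL1 hc hvol hcr using fun z (hz : z ∈ unitCyl d s) => ink_path d s hs z hz
  have hN1 := ink_density d hd s hs E hE hEt μ hμ (fun z _ => z) (by
    intro z _
    filter_upwards [self_mem_nhdsWithin] with r hr
    exact (ink_self d s z r hr).2)
  have hN2 := ink_density d hd s hs E hE hEt μ hμ c (by
    intro z hz
    have hz' := hEQ hz
    have ht : Filter.Tendsto (fun r : ℝ => r ^ (2 * s)) (nhdsWithin (0 : ℝ) (Ioi 0)) (nhds 0) := by
      have h1 : Continuous (fun r : ℝ => r ^ (2 * s)) :=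
        Real.continuous_rpow_const (by linarith [hs.1])
      have h2 := (h1.tendsto 0).mono_left (nhdsWithin_le_nhds (s := Ioi (0 : ℝ)))
      rwa [Real.zero_rpow (by linarith [hs.1])] at h2
    have hL' := hL z hz'
    filter_upwards [self_mem_nhdsWithin, ht.eventually (gt_mem_nhds (show 0 < L z / 4 by positivity))]
      with r hr h1
    exact (hcr z hz' r hr h1.le).2.1)
  set N1 := {z | z ∈ E ∧ ¬ ∀ᶠ r in nhdsWithin (0 : ℝ) (Ioi 0),
      ENNReal.ofReal (1 - μ) * volume (kinCyl d s z r) ≤ volume (kinCyl d s z r ∩ E)} with hN1d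
  set N2 := {z | z ∈ E ∧ ¬ ∀ᶠ r in nhdsWithin (0 : ℝ) (Ioi 0),
      ENNReal.ofReal (1 - μ) * volume (kinCyl d s (c z r) r) ≤
        volume (kinCyl d s (c z r) r ∩ E)} with hN2d
  set N := toMeasurable volume N1 with hN
  have hNm : MeasurableSet N := measurableSet_toMeasurable _ _
  have hN0 : volume N = 0 := by rw [hN, measure_toMeasurable, hN1]
  set B : Set (EuclideanSpace ℝ (Fin d) × EuclideanSpace ℝ (Fin d)) :=
    {w | 2 * volume (ink_fib d (unitCyl d s) w) ≤ volume (ink_fib d F w)} with hB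
  have hBm : MeasurableSet B :=
    measurableSet_le ((ink_fib_meas d _ hQm).const_mul 2) (ink_fib_meas d _ hF)
  have hlabm : Measurable (ink_lab d) := by
    apply Continuous.measurable
    unfold ink_lab
    fun_prop
  set E0 := {z | z ∈ E ∧ z ∉ N2 ∧ ink_lab d z ∉ B} with hE0
  set EB := E ∩ ink_lab d ⁻¹' B with hEB
  have hEBm : MeasurableSet EB := hE.inter (hlabm hBm)
  have hex : ∀ z ∈ E0, ∃ r, 0 < r ∧ r ≤ 1 ∧ ink_near d s z (c z r) r ∧
      kinCyl d s (c z r) r ⊆ unitCyl d s ∧ volume (kinCyl d s (c z r) r ∩ E) =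
        ENNReal.ofReal (1 - μ) * volume (kinCyl d s (c z r) r) := by
    rintro z ⟨hzE, hzN, hzB⟩
    have hz := hEQ hzE
    refine ink_cross d hd s hs μ m hμ hm E F hE hEQ hst z (L z) (c z) (hL z hz) (hc z hz)
      (hvol z hz) (hcr z hz) ?_ hzB
    by_contra hcon
    exact hzN ⟨hzE, hcon⟩
  choose! r hr0 hr1 hrn hrQ hrE using hex
  obtain ⟨u, huD, huc, hu⟩ := ink_vitali d hd s hs E0 Eᶜ hE.compl
    (ENNReal.ofReal μ) (fun z => c z (r z)) r hr0 hr1 hrn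
    (fun z hz => ink_compl_ge d hd s E hE μ hμ _ _ (hr0 z hz) (hrE z hz).le)
  set P := ⋃ z ∈ u, kinCyl d s (c z (r z)) (r z) with hP
  have hPm : MeasurableSet P := MeasurableSet.biUnion huc (fun z _ => ink_cyl_meas _ _ _ _)
  have hPQ : P ⊆ unitCyl d s := iUnion₂_subset fun z hz => hrQ z (huD hz)
  set G := (E ∪ P) \ N with hG
  have hGm : MeasurableSet G := MeasurableSet.diff (hE.union hPm) hNm
  have hGQ : G ⊆ unitCyl d s := sdiff_subset.trans (union_subset hEQ hPQ)
  have hGv : volume G = volume E + volume (P ∩ Eᶜ) := by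
    rw [hG, measure_sdiff_null hN0, ← union_sdiff_self, measure_union disjoint_sdiff_self_right
      (MeasurableSet.diff hPm hE)]
    rfl
  have hcov : ∀ z ∈ G, ∃ c r, 0 < r ∧ z ∈ kinCyl d s c r ∧ kinCylStack d s m c r ⊆ F := by
    rintro z ⟨hz | hz, hzN⟩
    · have h1 : ∀ᶠ r in nhdsWithin (0 : ℝ) (Ioi 0),
          ENNReal.ofReal (1 - μ) * volume (kinCyl d s z r) ≤ volume (kinCyl d s z r ∩ E) := by
        by_contra hcon
        exact hzN (subset_toMeasurable _ _ ⟨hz, hcon⟩)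
      obtain ⟨ρ, h1, h2, h3⟩ := (h1.and ((ink_self_sub d s hs z (hEQ hz)).and
        self_mem_nhdsWithin)).exists
      exact ⟨z, ρ, h3, (ink_self d s z ρ h3).1, hst z ρ h3 h2 h1⟩
    · obtain ⟨y, hy, hzy⟩ := mem_iUnion₂.1 hz
      have hy' := huD hy
      exact ⟨_, _, hr0 y hy', hzy, hst _ _ (hr0 y hy') (hrQ y hy') (hrE y hy').ge⟩
  have hlam : 1 ≤ ENNReal.ofReal ((m + 1) / m) := by
    rw [ENNReal.one_le_ofReal, one_le_div (by linarith)]; linarith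
  have hfib : ∀ w, volume (ink_fib d G w) + volume (ink_fib d EB w) ≤
      ENNReal.ofReal ((m + 1) / m) * volume (ink_fib d F w) := by
    intro w
    by_cases hw : w ∈ B
    · have h1 : volume (ink_fib d G w) ≤ volume (ink_fib d (unitCyl d s) w) :=
        measure_mono fun t ht => hGQ ht
      have h2 : volume (ink_fib d EB w) ≤ volume (ink_fib d (unitCyl d s) w) :=
        measure_mono fun t ht => hEQ ht.1
      calc _ ≤ _ := add_le_add h1 h2
        _ = 2 * volume (ink_fib d (unitCyl d s) w) := (two_mul _).symm
        _ ≤ volume (ink_fib d F w) := hw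
        _ = 1 * volume (ink_fib d F w) := (one_mul _).symm
        _ ≤ _ := by gcongr
    · have h1 : ink_fib d EB w = ∅ := by
        refine eq_empty_of_forall_notMem fun t ht => hw ?_
        have := ht.2
        rwa [mem_preimage, ink_lab_traj] at this
      rw [h1, measure_empty, add_zero]
      exact ink_fib_le d s m (by linarith) G F hcov w
  refine ⟨volume E0, volume EB, volume (P ∩ Eᶜ), hu, ?_, ?_⟩
  · have hsub : E ⊆ (E0 ∪ EB) ∪ N2 := by
      intro z hz
      by_cases h1 : z ∈ N2
      · exact Or.inr h1
      · by_cases h2 : ink_lab d z ∈ B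
        · exact Or.inl (Or.inr ⟨hz, h2⟩)
        · exact Or.inl (Or.inl ⟨hz, h1, h2⟩)
    calc volume E ≤ volume ((E0 ∪ EB) ∪ N2) := measure_mono hsub
      _ ≤ volume (E0 ∪ EB) + volume N2 := measure_union_le _ _
      _ = volume (E0 ∪ EB) := by rw [hN2, add_zero]
      _ ≤ _ := measure_union_le _ _
  · rw [← hGv, ink_fib_vol d G hGm, ink_fib_vol d EB hEBm, ink_fib_vol d F hF,
      ← lintegral_add_left (ink_fib_meas d G hGm), ← lintegral_const_mul _ (ink_fib_meas d F hF)]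
    exact lintegral_mono hfib

/-- **The ink-spots theorem for slanted kinetic cylinders.** There is `c ∈ (0,1)`,
depending only on `d` and `s`, such that: for `μ ∈ (0,1)`, `m ≥ 1`, and bounded
measurable sets `E ⊆ F` with `E ⊆ Q₁` and `|E| < (1-μ)|Q₁|`, if every slanted kinetic
cylinder `Q = Q_r(z₀) ⊆ Q₁` with `|Q ∩ E| ≥ (1-μ)|Q|` satisfies `Q̄^m(z₀,r) ⊆ F`, then
`|E| ≤ ((m+1)/m)(1 - cμ)|F|`. -/
theorem kinCyl_inkspots (d : ℕ) (hd : 1 ≤ d) (s : ℝ) (hs : s ∈ Set.Ioo (0 : ℝ) 1) :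
    ∃ c : ℝ, c ∈ Set.Ioo (0 : ℝ) 1 ∧
      ∀ (μ m : ℝ), μ ∈ Set.Ioo (0 : ℝ) 1 → 1 ≤ m →
      ∀ (E F : Set (Phase d)), MeasurableSet E → MeasurableSet F →
        Bornology.IsBounded E → Bornology.IsBounded F → E ⊆ F →
        E ⊆ unitCyl d s →
        volume E < ENNReal.ofReal (1 - μ) * volume (unitCyl d s) →
        (∀ (z₀ : Phase d) (r : ℝ), 0 < r → kinCyl d s z₀ r ⊆ unitCyl d s →
          ENNReal.ofReal (1 - μ) * volume (kinCyl d s z₀ r) ≤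
            volume (kinCyl d s z₀ r ∩ E) →
          kinCylStack d s m z₀ r ⊆ F) →
        volume E ≤ ENNReal.ofReal ((m + 1) / m * (1 - c * μ)) * volume F := by
  have hC := ink_C_ge d
  have hCpos : 0 < ink_C d := by linarith
  refine ⟨1 / (2 * ink_C d), ⟨by positivity, ?_⟩, ?_⟩
  · rw [div_lt_one (by positivity)]; linarith
  intro μ m hμ hm E F hE hF hEb hFb hEF hEQ _ hst
  have hFt : volume F ≠ ⊤ := hFb.measure_lt_top.ne
  have hEt : volume E ≠ ⊤ := hEb.measure_lt_top.ne
  set a := μ / ink_C d with ha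
  have ha0 : 0 < a := div_pos hμ.1 hCpos
  have ha1 : a ≤ 1 / 100 := by
    rw [ha, div_le_iff₀ hCpos]; linarith [hμ.2]
  have hca : 1 / (2 * ink_C d) * μ = a / 2 := by rw [ha]; field_simp
  rw [hca]
  rcases le_or_gt 17 m with hm17 | hm17
  · obtain ⟨e0, eb, pe, h1, h2, h3⟩ := ink_large d hd s hs μ m hμ hm17 E F hE hF hEQ hst
    have hRt : ENNReal.ofReal ((m + 1) / m) * volume F ≠ ⊤ :=
      (ENNReal.mul_lt_top ENNReal.ofReal_lt_top hFt.lt_top).ne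
    have h4 : ENNReal.ofReal a * e0 ≤ pe := by
      have hne : ENNReal.ofReal (ink_C d) ≠ 0 := (ENNReal.ofReal_pos.2 hCpos).ne'
      rw [ha, ENNReal.ofReal_div_of_pos hCpos, ← ENNReal.mul_div_right_comm]
      exact ENNReal.div_le_of_le_mul' h1
    have h5 : ENNReal.ofReal a * eb ≤ eb := by
      calc ENNReal.ofReal a * eb ≤ 1 * eb := by
            gcongr
            rw [ENNReal.ofReal_le_one]; linarith
        _ = eb := one_mul _
    have h6 : ENNReal.ofReal (1 + a) * volume E ≤ ENNReal.ofReal ((m + 1) / m) * volume F := by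
      calc ENNReal.ofReal (1 + a) * volume E = volume E + ENNReal.ofReal a * volume E := by
            rw [ENNReal.ofReal_add zero_le_one ha0.le, ENNReal.ofReal_one, add_mul, one_mul]
        _ ≤ volume E + ENNReal.ofReal a * (e0 + eb) := by gcongr
        _ = volume E + ENNReal.ofReal a * e0 + ENNReal.ofReal a * eb := by rw [mul_add, add_assoc]
        _ ≤ volume E + pe + eb := by gcongr
        _ ≤ _ := h3
    have h7 : 1 ≤ ENNReal.ofReal (1 - a / 2) * ENNReal.ofReal (1 + a) := by
      rw [← ENNReal.ofReal_mul (by linarith), ENNReal.one_le_ofReal]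
      nlinarith
    calc volume E = 1 * volume E := (one_mul _).symm
      _ ≤ ENNReal.ofReal (1 - a / 2) * ENNReal.ofReal (1 + a) * volume E := by gcongr
      _ = ENNReal.ofReal (1 - a / 2) * (ENNReal.ofReal (1 + a) * volume E) := mul_assoc _ _ _
      _ ≤ ENNReal.ofReal (1 - a / 2) * (ENNReal.ofReal ((m + 1) / m) * volume F) := by gcongr
      _ = _ := by
        rw [← mul_assoc, ← ENNReal.ofReal_mul (by linarith), mul_comm (1 - a / 2)]
  · calc volume E ≤ volume F := measure_mono hEF
      _ = 1 * volume F := (one_mul _).symm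
      _ ≤ _ := by
        gcongr
        rw [ENNReal.one_le_ofReal, div_mul_eq_mul_div, one_le_div (by linarith)]
        nlinarith
end
end

section
/- Estimates on the auxiliary kernel: let d ≥ 2, s ∈ [1/2,1), and let K : ℝ^d × ℝ^d → ℝ be a measurable kernel satisfying the tail bounds with constant Λ. For R > 0 and v, w ∈ ℝ^d with v ≠ w define A(v,w) = ∫_{{v' ∈ B_R(v) : (v'−v)·(w−v) ≥ |w−v|²}} |v'−v|^{d−2} |K(v,v')| / ( |w−v|^{d−2} |w−v'|^{d−2} ) dv' ∈ [0,∞]. Then there is a constant C, depending only on d, s and Λ, such that for every R > 0: (i) ∫_{B_R(v)} A(v,w) dw ≤ C R^{2−2s} for every v ∈ ℝ^d, and (ii) ∫_{B_R(w)} A(v,w) dv ≤ C R^{2−2s} for every w ∈ ℝ^d. -/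
open MeasureTheory Metric Set
open scoped RealInnerProductSpace

noncomputable section

/-- A measurable kernel `K : ℝ^d × ℝ^d → ℝ` satisfies the tail bounds with constant `Λ`. -/
def TailBounds (d : ℕ) (s Λ : ℝ)
    (K : EuclideanSpace ℝ (Fin d) → EuclideanSpace ℝ (Fin d) → ℝ) : Prop :=
  ∀ (v : EuclideanSpace ℝ (Fin d)) (r : ℝ), 0 < r →
    (∫⁻ v' in (Metric.ball v r)ᶜ, ENNReal.ofReal |K v v'|) ≤
        ENNReal.ofReal (Λ * r ^ (-(2 * s))) ∧
    (∫⁻ v' in (Metric.ball v r)ᶜ, ENNReal.ofReal |K v' v|) ≤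
        ENNReal.ofReal (Λ * r ^ (-(2 * s)))

/-- The auxiliary kernel
`A(v,w) = ∫_{{v' ∈ B_R(v) : (v'-v)·(w-v) ≥ |w-v|²}}
  |v'-v|^{d-2} |K(v,v')| / (|w-v|^{d-2} |w-v'|^{d-2}) dv'`, valued in `[0,∞]`. -/
def auxKernel (d : ℕ) (K : EuclideanSpace ℝ (Fin d) → EuclideanSpace ℝ (Fin d) → ℝ)
    (R : ℝ) (v w : EuclideanSpace ℝ (Fin d)) : ENNReal :=
  ∫⁻ v' in {v' ∈ Metric.ball v R | ‖w - v‖ ^ 2 ≤ ⟪v' - v, w - v⟫},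
    ENNReal.ofReal
      (‖v' - v‖ ^ ((d : ℝ) - 2) * |K v v'| /
        (‖w - v‖ ^ ((d : ℝ) - 2) * ‖w - v'‖ ^ ((d : ℝ) - 2)))


lemma aux_lint_rpow (R : ℝ) (hR : 0 ≤ R) (p : ℝ) (hp : -1 < p) :
    (∫⁻ y in Ioc (0:ℝ) R, ENNReal.ofReal (y ^ p)) = ENNReal.ofReal (R ^ (p + 1) / (p + 1)) := by
  have hI : IntegrableOn (fun y : ℝ => y ^ p) (Ioc 0 R) := by
    have := intervalIntegral.intervalIntegrable_rpow' (a := 0) (b := R) hp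
    rwa [intervalIntegrable_iff_integrableOn_Ioc_of_le hR] at this
  rw [← ofReal_integral_eq_lintegral_ofReal hI]
  · rw [← intervalIntegral.integral_of_le hR, integral_rpow (Or.inl hp),
      Real.zero_rpow (by linarith), sub_zero]
  · filter_upwards [ae_restrict_mem measurableSet_Ioc] with y hy
    exact Real.rpow_nonneg hy.1.le _

lemma aux_radial (d : ℕ) (hd : 2 ≤ d) (a : ℝ) (ha : -(d:ℝ) < a) :
    ∃ c : ℝ, 0 ≤ c ∧ ∀ (v : EuclideanSpace ℝ (Fin d)) (R : ℝ), 0 ≤ R →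
      (∫⁻ x in closedBall v R, ENNReal.ofReal (‖x - v‖ ^ a)) ≤
        ENNReal.ofReal (c * R ^ ((d:ℝ) + a)) := by
  have : Nonempty (Fin d) := ⟨⟨0, by omega⟩⟩
  let B : ℝ := (volume : Measure (EuclideanSpace ℝ (Fin d))).real (ball 0 1)
  have hB : 0 ≤ B := measureReal_nonneg
  refine ⟨d * (B * (1 / (d + a))), ?_, ?_⟩
  · have : 0 < (d:ℝ) + a := by linarith
    positivity
  intro v R hR
  let f : ℝ → ℝ := (Iic R).indicator (fun y => y ^ a)
  have h1 : (∫⁻ x in closedBall v R, ENNReal.ofReal (‖x - v‖ ^ a)) =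
      ∫⁻ x : EuclideanSpace ℝ (Fin d), ENNReal.ofReal (f ‖x‖) := by
    rw [← lintegral_sub_right_eq_self (fun x => ENNReal.ofReal (f ‖x‖)) v,
      ← lintegral_indicator measurableSet_closedBall]
    congr 1
    ext x
    by_cases hx : ‖x - v‖ ≤ R <;> simp [f, indicator, hx, dist_eq_norm]
  have hcongr : ∀ y ∈ Ioi (0:ℝ), y ^ (d - 1) • f y =
      (Ioc 0 R).indicator (fun y => y ^ ((d:ℝ) - 1 + a)) y := by
    intro y hy
    have hy : 0 < y := hy
    by_cases hyR : y ≤ R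
    · simp only [f, indicator, mem_Iic, hyR, mem_Ioc, hy, and_self, if_true, smul_eq_mul]
      rw [Real.rpow_add hy, ← Real.rpow_natCast, Nat.cast_sub (by omega), Nat.cast_one]
    · simp [f, indicator, hyR]
  have hp : -1 < (d:ℝ) - 1 + a := by linarith
  have hI : IntegrableOn (fun y : ℝ => y ^ ((d:ℝ) - 1 + a)) (Ioc 0 R) := by
    have := intervalIntegral.intervalIntegrable_rpow' (a := 0) (b := R) hp
    rwa [intervalIntegrable_iff_integrableOn_Ioc_of_le hR] at this
  have hint : Integrable (fun x : EuclideanSpace ℝ (Fin d) => f ‖x‖) := by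
    rw [integrable_fun_norm_addHaar]
    rw [finrank_euclideanSpace_fin, integrableOn_congr_fun hcongr measurableSet_Ioi]
    exact ((integrable_indicator_iff measurableSet_Ioc).2 hI).integrableOn
  rw [h1, ← ofReal_integral_eq_lintegral_ofReal hint]
  · apply ENNReal.ofReal_le_ofReal
    rw [integral_fun_norm_addHaar, finrank_euclideanSpace_fin,
      setIntegral_congr_fun measurableSet_Ioi hcongr, setIntegral_indicator measurableSet_Ioc,
      inter_eq_right.2 (fun y hy => hy.1), ← intervalIntegral.integral_of_le hR,
      integral_rpow (Or.inl hp), Real.zero_rpow (by linarith), sub_zero]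
    simp only [nsmul_eq_mul, smul_eq_mul]
    rw [show (d:ℝ) - 1 + a + 1 = d + a by ring]
    apply le_of_eq
    change (d:ℝ) * (B * _) = _
    ring
  · filter_upwards with x
    simp only [f, indicator]
    split_ifs
    · exact Real.rpow_nonneg (norm_nonneg _) _
    · simp

lemma aux_alg (e : ℝ) (he : 0 ≤ e) (p a b : ℝ) (hp : 0 ≤ p) (ha : 0 ≤ a) (hab : a ≤ b)
    (h : p ≤ a + b) : p ^ e / (a ^ e * b ^ e) ≤ 2 ^ e * a ^ (-e) := by
  rw [Real.rpow_neg ha]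
  have h2 : p ^ e ≤ 2 ^ e * b ^ e := by
    rw [← Real.mul_rpow (by norm_num) (by linarith)]
    exact Real.rpow_le_rpow hp (by linarith) he
  have hb : 0 ≤ b ^ e := Real.rpow_nonneg (by linarith) _
  have h3 : p ^ e / b ^ e ≤ 2 ^ e := by
    apply div_le_of_le_mul₀ hb (by positivity) h2
  calc p ^ e / (a ^ e * b ^ e) = (p ^ e / b ^ e) * (a ^ e)⁻¹ := by
        rw [div_eq_mul_inv, mul_inv, div_eq_mul_inv]; ring
    _ ≤ _ := by gcongr

/-- Second moment bound by layer cake. -/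
lemma aux_moment (d : ℕ) (s Λ : ℝ) (hs : s < 1) (hΛ : 0 < Λ)
    (k : EuclideanSpace ℝ (Fin d) → ℝ) (hk : Measurable k) (v : EuclideanSpace ℝ (Fin d))
    (ht : ∀ r : ℝ, 0 < r → (∫⁻ v' in (ball v r)ᶜ, ENNReal.ofReal |k v'|) ≤
        ENNReal.ofReal (Λ * r ^ (-(2 * s)))) (R : ℝ) (hR : 0 < R) :
    (∫⁻ v' in ball v R, ENNReal.ofReal (‖v' - v‖ ^ 2 * |k v'|)) ≤
      ENNReal.ofReal (Λ / (1 - s) * R ^ (2 - 2 * s)) := by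
  have key : ∀ v' ∈ ball v R, ENNReal.ofReal (‖v' - v‖ ^ 2 * |k v'|) =
      ∫⁻ r in Ioc 0 R, (if r ≤ ‖v' - v‖ then
        ENNReal.ofReal (2 * r) * ENNReal.ofReal |k v'| else 0) := by
    intro v' hv'
    have hv' : ‖v' - v‖ < R := by rwa [mem_ball, dist_eq_norm] at hv'
    have h0 := aux_lint_rpow ‖v' - v‖ (norm_nonneg _) 1 (by norm_num)
    rw [ENNReal.ofReal_mul (by positivity)]
    have : ENNReal.ofReal (‖v' - v‖ ^ 2) = ∫⁻ r in Ioc 0 ‖v' - v‖, ENNReal.ofReal (2 * r) := by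
      simp_rw [ENNReal.ofReal_mul (show (0:ℝ) ≤ 2 by norm_num)]
      rw [lintegral_const_mul _ (by fun_prop)]
      simp only [Real.rpow_one] at h0
      rw [h0, ← ENNReal.ofReal_mul (by norm_num), show (1:ℝ) + 1 = (2:ℕ) by norm_num,
        Real.rpow_natCast]
      congr 1
      push_cast
      ring
    rw [this, ← lintegral_mul_const _ (by fun_prop), ← lintegral_indicator measurableSet_Ioc,
      ← lintegral_indicator measurableSet_Ioc]
    congr 1
    ext r
    simp only [indicator, mem_Ioc]
    by_cases h1 : 0 < r <;> by_cases h2 : r ≤ ‖v' - v‖ <;> by_cases h3 : r ≤ R <;>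
      simp [h1, h2, h3]
    exact absurd (h2.trans hv'.le) h3
  rw [setLIntegral_congr_fun measurableSet_ball key, lintegral_lintegral_swap]
  · calc _ ≤ ∫⁻ r in Ioc 0 R, ENNReal.ofReal (2 * Λ) * ENNReal.ofReal (r ^ (1 - 2 * s)) := by
          apply setLIntegral_mono' measurableSet_Ioc
          intro r hr
          have hr0 : 0 < r := hr.1
          calc _ ≤ ∫⁻ v', (if r ≤ ‖v' - v‖ then
                  ENNReal.ofReal (2 * r) * ENNReal.ofReal |k v'| else 0) :=
                setLIntegral_le_lintegral _ _
            _ = ∫⁻ v' in (ball v r)ᶜ, ENNReal.ofReal (2 * r) * ENNReal.ofReal |k v'| := by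
                rw [← lintegral_indicator measurableSet_ball.compl]
                congr 1
                ext x
                simp [indicator, dist_eq_norm]
            _ = ENNReal.ofReal (2 * r) * ∫⁻ v' in (ball v r)ᶜ, ENNReal.ofReal |k v'| := by
                rw [lintegral_const_mul _ (by fun_prop)]
            _ ≤ ENNReal.ofReal (2 * r) * ENNReal.ofReal (Λ * r ^ (-(2 * s))) := by
                gcongr; exact ht r hr0
            _ = _ := by
                rw [← ENNReal.ofReal_mul (by positivity), ← ENNReal.ofReal_mul (by positivity)]
                congr 1
                rw [sub_eq_add_neg, Real.rpow_add hr0, Real.rpow_one]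
                ring
    _ = _ := by
          rw [lintegral_const_mul _ (by fun_prop), aux_lint_rpow R hR.le _ (by linarith),
            ← ENNReal.ofReal_mul (by positivity)]
          congr 1
          rw [show 1 - 2 * s + 1 = 2 - 2 * s by ring]
          have : 1 - s ≠ 0 := by linarith
          have : 2 - 2 * s ≠ 0 := by intro h; apply this; linarith
          field_simp
  · apply Measurable.aemeasurable
    apply Measurable.ite
    · exact measurableSet_le (by fun_prop) (by fun_prop)
    · fun_prop
    · fun_prop

/-- Half of the second estimate. -/
lemma aux_half (d : ℕ) (hd : 2 ≤ d) (s Λ : ℝ) (hs : s < 1) (hΛ : 0 < Λ) :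
    ∃ C : ℝ, 0 ≤ C ∧ ∀ k : EuclideanSpace ℝ (Fin d) → EuclideanSpace ℝ (Fin d) → ℝ,
      Measurable (Function.uncurry k) →
      (∀ x, ∀ r : ℝ, 0 < r → (∫⁻ y in (ball x r)ᶜ, ENNReal.ofReal |k x y|) ≤
        ENNReal.ofReal (Λ * r ^ (-(2 * s)))) → ∀ (R : ℝ), 0 < R → 
      ∀ w : EuclideanSpace ℝ (Fin d), 
      (∫⁻ x in ball w R, ∫⁻ y in (ball x ‖x - w‖)ᶜ,
        ENNReal.ofReal (‖x - w‖ ^ (-((d:ℝ) - 2))) * ENNReal.ofReal |k x y|) ≤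
        ENNReal.ofReal (C * R ^ (2 - 2 * s)) := by
  have : Nonempty (Fin d) := ⟨⟨0, by omega⟩⟩
  obtain ⟨c, hc, hrad⟩ := aux_radial d hd (-((d:ℝ) - 2) + -(2 * s)) (by linarith)
  refine ⟨Λ * c, by positivity, ?_⟩
  intro k hk ht R hR w
  calc _ ≤ ∫⁻ x in ball w R, ENNReal.ofReal Λ *
        ENNReal.ofReal (‖x - w‖ ^ (-((d:ℝ) - 2) + -(2 * s))) := by
        apply setLIntegral_mono_ae' measurableSet_ball
        have : ∀ᵐ x : EuclideanSpace ℝ (Fin d), x ≠ w := by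
          simp [ae_iff]
        filter_upwards [this] with x hx _
        have hpos : 0 < ‖x - w‖ := norm_pos_iff.2 (sub_ne_zero.2 hx)
        rw [lintegral_const_mul _ (by fun_prop)]
        calc _ ≤ ENNReal.ofReal (‖x - w‖ ^ (-((d:ℝ) - 2))) *
              ENNReal.ofReal (Λ * ‖x - w‖ ^ (-(2 * s))) := by
              gcongr; exact ht x _ hpos
          _ = _ := by
              rw [← ENNReal.ofReal_mul (by positivity), ← ENNReal.ofReal_mul (by positivity),
                Real.rpow_add hpos]
              congr 1; ring
    _ = ENNReal.ofReal Λ * ∫⁻ x in ball w R, 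
        ENNReal.ofReal (‖x - w‖ ^ (-((d:ℝ) - 2) + -(2 * s))) := by
        rw [lintegral_const_mul _ (by fun_prop)]
    _ ≤ ENNReal.ofReal Λ * ENNReal.ofReal (c * R ^ ((d:ℝ) + (-((d:ℝ) - 2) + -(2 * s)))) := by
        gcongr
        exact (lintegral_mono_set ball_subset_closedBall).trans (hrad w R hR.le)
    _ = _ := by
        rw [← ENNReal.ofReal_mul (by positivity)]
        congr 1
        rw [show (d:ℝ) + (-((d:ℝ) - 2) + -(2 * s)) = 2 - 2 * s by ring]
        ring

/-- Geometry: the triangle `v, w, v'` has a non-acute angle at `w`. -/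
lemma aux_geom (d : ℕ) (v w v' : EuclideanSpace ℝ (Fin d))
    (h : ‖w - v‖ ^ 2 ≤ ⟪v' - v, w - v⟫) :
    ‖w - v‖ ≤ ‖v' - v‖ ∧ ‖w - v'‖ ≤ ‖v' - v‖ := by
  have h1 : ‖v' - v‖ ^ 2 = ‖w - v‖ ^ 2 + 2 * (⟪v' - v, w - v⟫ - ‖w - v‖ ^ 2) + ‖w - v'‖ ^ 2 := by
    have : w - v' = (w - v) - (v' - v) := by abel
    rw [this, norm_sub_sq_real (w - v) (v' - v), real_inner_comm]
    ring
  constructor <;> refine le_of_sq_le_sq ?_ (norm_nonneg _)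
  · nlinarith [sq_nonneg ‖w - v'‖]
  · nlinarith [sq_nonneg ‖w - v‖]

lemma aux_measSet (d : ℕ) (R : ℝ) (v w : EuclideanSpace ℝ (Fin d)) :
    MeasurableSet {v' ∈ Metric.ball v R | ‖w - v‖ ^ 2 ≤ ⟪v' - v, w - v⟫} := by
  have h : MeasurableSet {v' : EuclideanSpace ℝ (Fin d) | ‖w - v‖ ^ 2 ≤ ⟪v' - v, w - v⟫} :=
    measurableSet_le measurable_const
      (Continuous.measurable (by fun_prop))
  exact measurableSet_ball.inter h

/-- The integrand of the auxiliary kernel with the constraint as an indicator. -/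
lemma aux_pointwise (d : ℕ) (hd : 2 ≤ d) (κ : ℝ) (v w v' : EuclideanSpace ℝ (Fin d))
    (h : ‖w - v‖ ^ 2 ≤ ⟪v' - v, w - v⟫) (hle : ‖w - v‖ ≤ ‖w - v'‖) :
    ENNReal.ofReal (‖v' - v‖ ^ ((d : ℝ) - 2) * |κ| /
        (‖w - v‖ ^ ((d : ℝ) - 2) * ‖w - v'‖ ^ ((d : ℝ) - 2))) ≤
      ENNReal.ofReal (2 ^ ((d:ℝ) - 2)) *
        (ENNReal.ofReal (‖w - v‖ ^ (-((d:ℝ) - 2))) * ENNReal.ofReal |κ|) := by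
  have he : (0:ℝ) ≤ (d:ℝ) - 2 := by
    have : (2:ℝ) ≤ d := by exact_mod_cast hd
    linarith
  have htri : ‖v' - v‖ ≤ ‖w - v‖ + ‖w - v'‖ := by
    have : v' - v = (w - v) - (w - v') := by abel
    rw [this]; exact norm_sub_le _ _
  have := aux_alg _ he ‖v' - v‖ ‖w - v‖ ‖w - v'‖ (norm_nonneg _) (norm_nonneg _) hle htri
  rw [← ENNReal.ofReal_mul (by positivity), ← ENNReal.ofReal_mul (by positivity)]
  apply ENNReal.ofReal_le_ofReal
  rw [mul_div_right_comm, ← mul_assoc]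
  gcongr

lemma aux_pointwise' (d : ℕ) (hd : 2 ≤ d) (κ : ℝ) (v w v' : EuclideanSpace ℝ (Fin d))
    (h : ‖w - v‖ ^ 2 ≤ ⟪v' - v, w - v⟫) (hle : ‖w - v'‖ ≤ ‖w - v‖) :
    ENNReal.ofReal (‖v' - v‖ ^ ((d : ℝ) - 2) * |κ| /
        (‖w - v‖ ^ ((d : ℝ) - 2) * ‖w - v'‖ ^ ((d : ℝ) - 2))) ≤
      ENNReal.ofReal (2 ^ ((d:ℝ) - 2)) *
        (ENNReal.ofReal (‖w - v'‖ ^ (-((d:ℝ) - 2))) * ENNReal.ofReal |κ|) := by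
  have he : (0:ℝ) ≤ (d:ℝ) - 2 := by
    have : (2:ℝ) ≤ d := by exact_mod_cast hd
    linarith
  have htri : ‖v' - v‖ ≤ ‖w - v'‖ + ‖w - v‖ := by
    have : v' - v = (w - v) - (w - v') := by abel
    rw [this, add_comm]; exact norm_sub_le _ _
  have := aux_alg _ he ‖v' - v‖ ‖w - v'‖ ‖w - v‖ (norm_nonneg _) (norm_nonneg _) hle htri
  rw [← ENNReal.ofReal_mul (by positivity), ← ENNReal.ofReal_mul (by positivity)]
  apply ENNReal.ofReal_le_ofReal
  rw [mul_div_right_comm, ← mul_assoc, mul_comm (‖w - v‖ ^ ((d : ℝ) - 2))]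
  gcongr

set_option maxHeartbeats 1000000 in
lemma aux_first (d : ℕ) (hd : 2 ≤ d) (s Λ : ℝ) (hs : s < 1) (hΛ : 0 < Λ) :
    ∃ C : ℝ, 0 ≤ C ∧
      ∀ (K : EuclideanSpace ℝ (Fin d) → EuclideanSpace ℝ (Fin d) → ℝ),
        Measurable (Function.uncurry K) → TailBounds d s Λ K →
      ∀ (R : ℝ), 0 < R → ∀ v : EuclideanSpace ℝ (Fin d),
          (∫⁻ w in Metric.ball v R, auxKernel d K R v w) ≤
            ENNReal.ofReal (C * R ^ (2 - 2 * s)) := by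
  obtain ⟨c, hc, hrad⟩ := aux_radial d hd (-((d:ℝ) - 2)) (by linarith)
  have h1s : 0 < 1 - s := by linarith
  refine ⟨2 ^ ((d:ℝ) - 2) * (2 * c) * (Λ / (1 - s)), by positivity, ?_⟩
  intro K hK ht R hR v
  have hKv : Measurable (K v) := hK.comp measurable_prodMk_left
  -- the dominating kernel
  let G : EuclideanSpace ℝ (Fin d) → EuclideanSpace ℝ (Fin d) → ENNReal := fun w v' =>
    ENNReal.ofReal (2 ^ ((d:ℝ) - 2)) * ENNReal.ofReal |K v v'| *
      ((if ‖w - v‖ ≤ ‖v' - v‖ then ENNReal.ofReal (‖w - v‖ ^ (-((d:ℝ) - 2))) else 0) +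
       (if ‖w - v'‖ ≤ ‖v' - v‖ then ENNReal.ofReal (‖w - v'‖ ^ (-((d:ℝ) - 2))) else 0))
  have hm1 : Measurable (fun p : EuclideanSpace ℝ (Fin d) × EuclideanSpace ℝ (Fin d) =>
      if ‖p.1 - v‖ ≤ ‖p.2 - v‖ then ENNReal.ofReal (‖p.1 - v‖ ^ (-((d:ℝ) - 2))) else 0) :=
    Measurable.ite (measurableSet_le (by fun_prop) (by fun_prop)) (by fun_prop) (by fun_prop)
  have hm2 : Measurable (fun p : EuclideanSpace ℝ (Fin d) × EuclideanSpace ℝ (Fin d) =>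
      if ‖p.1 - p.2‖ ≤ ‖p.2 - v‖ then ENNReal.ofReal (‖p.1 - p.2‖ ^ (-((d:ℝ) - 2))) else 0) :=
    Measurable.ite (measurableSet_le (by fun_prop) (by fun_prop)) (by fun_prop) (by fun_prop)
  have hGm : Measurable (Function.uncurry G) := by
    have : Measurable (fun p : EuclideanSpace ℝ (Fin d) × EuclideanSpace ℝ (Fin d) =>
      ENNReal.ofReal (2 ^ ((d:ℝ) - 2)) * ENNReal.ofReal |K v p.2|) := by fun_prop
    exact this.mul (hm1.add hm2)
  have hA : ∀ w, auxKernel d K R v w ≤ ∫⁻ v' in ball v R, G w v' := by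
    intro w
    have hS : MeasurableSet {v' ∈ Metric.ball v R | ‖w - v‖ ^ 2 ≤ ⟪v' - v, w - v⟫} :=
      aux_measSet d R v w
    refine le_trans (setLIntegral_mono' hS ?_) (lintegral_mono_set (sep_subset _ _))
    rintro v' ⟨_, h⟩
    obtain ⟨g1, g2⟩ := aux_geom d v w v' h
    simp only [G, g1, g2, if_true]
    rcases le_total ‖w - v‖ ‖w - v'‖ with hle | hle
    · refine (aux_pointwise d hd _ v w v' h hle).trans ?_
      rw [mul_comm (ENNReal.ofReal (‖w - v‖ ^ _)), ← mul_assoc]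
      gcongr
      exact le_self_add
    · refine (aux_pointwise' d hd _ v w v' h hle).trans ?_
      rw [mul_comm (ENNReal.ofReal (‖w - v'‖ ^ _)), ← mul_assoc]
      gcongr
      exact le_add_self
  have hin : ∀ v', ∫⁻ w, G w v' ≤ ENNReal.ofReal (2 ^ ((d:ℝ) - 2) * (2 * c)) *
      ENNReal.ofReal (‖v' - v‖ ^ 2 * |K v v'|) := by
    intro v'
    have hball : ∀ z : EuclideanSpace ℝ (Fin d),
        (∫⁻ w, (if ‖w - z‖ ≤ ‖v' - v‖ then ENNReal.ofReal (‖w - z‖ ^ (-((d:ℝ) - 2))) else 0)) ≤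
        ENNReal.ofReal (c * ‖v' - v‖ ^ 2) := by
      intro z
      have := hrad z ‖v' - v‖ (norm_nonneg _)
      rw [show (d:ℝ) + -((d:ℝ) - 2) = (2:ℕ) by push_cast; ring, Real.rpow_natCast] at this
      refine le_trans (le_of_eq ?_) this
      rw [← lintegral_indicator measurableSet_closedBall]
      refine lintegral_congr fun x => ?_
      simp [indicator, dist_eq_norm]
    have q1 : Measurable (fun w : EuclideanSpace ℝ (Fin d) =>
      if ‖w - v‖ ≤ ‖v' - v‖ then ENNReal.ofReal (‖w - v‖ ^ (-((d:ℝ) - 2))) else 0) :=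
      Measurable.ite (measurableSet_le (by fun_prop) (by fun_prop)) (by fun_prop) (by fun_prop)
    have q2 : Measurable (fun w : EuclideanSpace ℝ (Fin d) =>
      if ‖w - v'‖ ≤ ‖v' - v‖ then ENNReal.ofReal (‖w - v'‖ ^ (-((d:ℝ) - 2))) else 0) :=
      Measurable.ite (measurableSet_le (by fun_prop) (by fun_prop)) (by fun_prop) (by fun_prop)
    simp only [G]
    rw [lintegral_const_mul' _ _ (ENNReal.mul_ne_top ENNReal.ofReal_ne_top ENNReal.ofReal_ne_top), lintegral_add_left q1]
    calc _ ≤ ENNReal.ofReal (2 ^ ((d:ℝ) - 2)) * ENNReal.ofReal |K v v'| *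
          (ENNReal.ofReal (c * ‖v' - v‖ ^ 2) + ENNReal.ofReal (c * ‖v' - v‖ ^ 2)) := by
          gcongr
          · exact hball v
          · exact hball v'
      _ = _ := by
          rw [← ENNReal.ofReal_add (by positivity) (by positivity),
            ← ENNReal.ofReal_mul (by positivity), ← ENNReal.ofReal_mul (by positivity),
            ← ENNReal.ofReal_mul (by positivity)]
          congr 1
          ring
  calc _ ≤ ∫⁻ w in ball v R, ∫⁻ v' in ball v R, G w v' := lintegral_mono hA
    _ = ∫⁻ v' in ball v R, ∫⁻ w in ball v R, G w v' :=
        lintegral_lintegral_swap hGm.aemeasurable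
    _ ≤ ∫⁻ v' in ball v R, ENNReal.ofReal (2 ^ ((d:ℝ) - 2) * (2 * c)) *
          ENNReal.ofReal (‖v' - v‖ ^ 2 * |K v v'|) := by
        apply lintegral_mono
        intro v'
        exact (setLIntegral_le_lintegral _ _).trans (hin v')
    _ = ENNReal.ofReal (2 ^ ((d:ℝ) - 2) * (2 * c)) * ∫⁻ v' in ball v R,
          ENNReal.ofReal (‖v' - v‖ ^ 2 * |K v v'|) := by
        rw [lintegral_const_mul _ (by fun_prop)]
    _ ≤ ENNReal.ofReal (2 ^ ((d:ℝ) - 2) * (2 * c)) *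
          ENNReal.ofReal (Λ / (1 - s) * R ^ (2 - 2 * s)) := by
        gcongr
        exact aux_moment d s Λ hs hΛ (K v) hKv v (fun r hr => (ht v r hr).1) R hR
    _ = _ := by
        rw [← ENNReal.ofReal_mul (by positivity)]
        congr 1
        ring

/-- Weighted far-away part of a kernel. -/
def auxG (d : ℕ) (w x y : EuclideanSpace ℝ (Fin d))
    (k : EuclideanSpace ℝ (Fin d) → EuclideanSpace ℝ (Fin d) → ℝ) : ENNReal :=
  if ‖x - w‖ ≤ ‖y - x‖ then
    ENNReal.ofReal (‖x - w‖ ^ (-((d:ℝ) - 2))) * ENNReal.ofReal |k x y| else 0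

lemma aux_gmeas (d : ℕ) (w : EuclideanSpace ℝ (Fin d)) (k : EuclideanSpace ℝ (Fin d) →
    EuclideanSpace ℝ (Fin d) → ℝ) (hk : Measurable (Function.uncurry k))
    {α : Type} [MeasurableSpace α] (f g : α → EuclideanSpace ℝ (Fin d))
    (hf : Measurable f) (hg : Measurable g) :
    Measurable (fun p : α => auxG d w (f p) (g p) k) := by
  unfold auxG
  refine Measurable.ite (measurableSet_le (by fun_prop) (by fun_prop)) ?_ (by fun_prop)
  have : Measurable (fun p : α => k (f p) (g p)) := hk.comp (hf.prodMk hg)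
  fun_prop

lemma aux_gbound (d : ℕ) (hd : 2 ≤ d) (R : ℝ)
    (K : EuclideanSpace ℝ (Fin d) → EuclideanSpace ℝ (Fin d) → ℝ)
    (w v : EuclideanSpace ℝ (Fin d)) (hv : v ∈ ball w R) :
    auxKernel d K R v w ≤ ∫⁻ v', ENNReal.ofReal (2 ^ ((d:ℝ) - 2)) *
      (auxG d w v v' K +
        (ball w R).indicator (fun v' => auxG d w v' v (fun x y => K y x)) v') := by
  have hv : ‖v - w‖ < R := by rwa [mem_ball, dist_eq_norm] at hv
  have hS : MeasurableSet {v' ∈ Metric.ball v R | ‖w - v‖ ^ 2 ≤ ⟪v' - v, w - v⟫} :=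
    aux_measSet d R v w
  refine le_trans (setLIntegral_mono' hS ?_) (setLIntegral_le_lintegral _ _)
  rintro v' ⟨_, h⟩
  obtain ⟨g1, g2⟩ := aux_geom d v w v' h
  rcases le_total ‖w - v‖ ‖w - v'‖ with hle | hle
  · refine (aux_pointwise d hd _ v w v' h hle).trans ?_
    gcongr
    refine le_trans ?_ le_self_add
    rw [norm_sub_rev w v] at g1 ⊢
    simp only [auxG, g1, if_true, le_refl]
  · refine (aux_pointwise' d hd _ v w v' h hle).trans ?_
    gcongr
    refine le_trans ?_ le_add_self
    rw [norm_sub_rev w v, norm_sub_rev w v'] at hle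
    rw [norm_sub_rev w v', norm_sub_rev v' v] at g2
    have hmem : v' ∈ ball w R := by
      rw [mem_ball, dist_eq_norm]; linarith
    rw [indicator_of_mem hmem, norm_sub_rev w v']
    simp only [auxG, g2, if_true, le_refl]

set_option maxHeartbeats 1000000 in
lemma aux_second (d : ℕ) (hd : 2 ≤ d) (s Λ : ℝ) (hs : s < 1) (hΛ : 0 < Λ) :
    ∃ C : ℝ, 0 ≤ C ∧
      ∀ (K : EuclideanSpace ℝ (Fin d) → EuclideanSpace ℝ (Fin d) → ℝ),
        Measurable (Function.uncurry K) → TailBounds d s Λ K →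
      ∀ (R : ℝ), 0 < R → ∀ w : EuclideanSpace ℝ (Fin d),
          (∫⁻ v in Metric.ball w R, auxKernel d K R v w) ≤
            ENNReal.ofReal (C * R ^ (2 - 2 * s)) := by
  obtain ⟨c, hc, hhalf⟩ := aux_half d hd s Λ hs hΛ
  refine ⟨2 ^ ((d:ℝ) - 2) * (2 * c), by positivity, ?_⟩
  intro K hK ht R hR w
  have hhalf' : ∀ k, Measurable (Function.uncurry k) →
      (∀ x, ∀ r : ℝ, 0 < r → (∫⁻ y in (ball x r)ᶜ, ENNReal.ofReal |k x y|) ≤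
        ENNReal.ofReal (Λ * r ^ (-(2 * s)))) →
      (∫⁻ x in ball w R, ∫⁻ y, auxG d w x y k) ≤ ENNReal.ofReal (c * R ^ (2 - 2 * s)) := by
    intro k hk htk
    refine le_trans (le_of_eq ?_) (hhalf k hk htk R hR w)
    refine lintegral_congr fun x => ?_
    rw [← lintegral_indicator measurableSet_ball.compl]
    refine lintegral_congr fun y => ?_
    simp [auxG, indicator, dist_eq_norm]
  obtain ⟨K', hKe⟩ : ∃ K' : EuclideanSpace ℝ (Fin d) → EuclideanSpace ℝ (Fin d) → ℝ,
    K' = fun x y => K y x := ⟨_, rfl⟩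
  have hK' : Measurable (Function.uncurry K') := by
    rw [hKe]; exact hK.comp measurable_swap
  have ht' : ∀ x, ∀ r : ℝ, 0 < r → (∫⁻ y in (ball x r)ᶜ, ENNReal.ofReal |K' x y|) ≤
        ENNReal.ofReal (Λ * r ^ (-(2 * s))) := by
    rw [hKe]; exact fun x r hr => (ht x r hr).2
  have hA : ∀ v ∈ ball w R, auxKernel d K R v w ≤ ∫⁻ v', ENNReal.ofReal (2 ^ ((d:ℝ) - 2)) *
      (auxG d w v v' K + (ball w R).indicator (fun v' => auxG d w v' v K') v') := by
    rw [hKe]; exact fun v hv => aux_gbound d hd R K w v hv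
  have hmi : Measurable (fun p : EuclideanSpace ℝ (Fin d) × EuclideanSpace ℝ (Fin d) =>
      auxG d w p.2 p.1 K') :=
    aux_gmeas d w K' hK' Prod.snd Prod.fst measurable_snd measurable_fst
  have hmj : Measurable (fun p : EuclideanSpace ℝ (Fin d) × EuclideanSpace ℝ (Fin d) =>
      auxG d w p.1 p.2 K) :=
    aux_gmeas d w K hK Prod.fst Prod.snd measurable_fst measurable_snd
  have hg1 : ∀ v, Measurable (fun v' => auxG d w v v' K) := fun v =>
    aux_gmeas d w K hK (fun _ => v) (fun v' => v') measurable_const measurable_id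
  have hg2 : ∀ v, Measurable (fun v' => auxG d w v' v K') := fun v =>
    aux_gmeas d w K' hK' (fun v' => v') (fun _ => v) measurable_id measurable_const
  calc _ ≤ ∫⁻ v in ball w R, ∫⁻ v', ENNReal.ofReal (2 ^ ((d:ℝ) - 2)) *
      (auxG d w v v' K + (ball w R).indicator (fun v' => auxG d w v' v K') v') :=
        setLIntegral_mono' measurableSet_ball hA
    _ = ∫⁻ v in ball w R, ENNReal.ofReal (2 ^ ((d:ℝ) - 2)) *
      ((∫⁻ v', auxG d w v v' K) + ∫⁻ v' in ball w R, auxG d w v' v K') := by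
        refine lintegral_congr fun v => ?_
        rw [lintegral_const_mul' _ _ ENNReal.ofReal_ne_top,
          lintegral_add_left (hg1 v), lintegral_indicator measurableSet_ball]
    _ = ENNReal.ofReal (2 ^ ((d:ℝ) - 2)) * ((∫⁻ v in ball w R, ∫⁻ v', auxG d w v v' K) +
          ∫⁻ v in ball w R, ∫⁻ v' in ball w R, auxG d w v' v K') := by
        rw [lintegral_const_mul' _ _ ENNReal.ofReal_ne_top, lintegral_add_left]
        exact hmj.lintegral_prod_right'
    _ = ENNReal.ofReal (2 ^ ((d:ℝ) - 2)) * ((∫⁻ v in ball w R, ∫⁻ v', auxG d w v v' K) +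
          ∫⁻ v' in ball w R, ∫⁻ v in ball w R, auxG d w v' v K') := by
        rw [lintegral_lintegral_swap (f := fun v v' => auxG d w v' v K') hmi.aemeasurable]
    _ ≤ ENNReal.ofReal (2 ^ ((d:ℝ) - 2)) * (ENNReal.ofReal (c * R ^ (2 - 2 * s)) +
          ENNReal.ofReal (c * R ^ (2 - 2 * s))) := by
        gcongr
        · exact hhalf' K hK (fun x r hr => (ht x r hr).1)
        · refine le_trans (lintegral_mono fun v' => setLIntegral_le_lintegral _ _)
            (hhalf' K' hK' ht')
    _ = _ := by
        rw [← ENNReal.ofReal_add (by positivity) (by positivity),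
          ← ENNReal.ofReal_mul (by positivity)]
        congr 1
        ring

/-- **Estimates on the auxiliary kernel.** For `d ≥ 2`, `s ∈ [1/2, 1)` and a kernel `K`
satisfying the tail bounds with constant `Λ`, there is `C`, depending only on `d`, `s`
and `Λ`, such that `∫_{B_R(v)} A(v,w) dw ≤ C R^{2-2s}` and
`∫_{B_R(w)} A(v,w) dv ≤ C R^{2-2s}` for every `R > 0`. -/
theorem auxKernel_estimates (d : ℕ) (hd : 2 ≤ d) (s : ℝ)
    (hs : s ∈ Set.Ico (1 / 2 : ℝ) 1) (Λ : ℝ) (hΛ : 0 < Λ) :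
    ∃ C : ℝ, 0 < C ∧
      ∀ (K : EuclideanSpace ℝ (Fin d) → EuclideanSpace ℝ (Fin d) → ℝ),
        Measurable (Function.uncurry K) → TailBounds d s Λ K →
      ∀ (R : ℝ), 0 < R →
        (∀ v : EuclideanSpace ℝ (Fin d),
          (∫⁻ w in Metric.ball v R, auxKernel d K R v w) ≤
            ENNReal.ofReal (C * R ^ (2 - 2 * s))) ∧
        (∀ w : EuclideanSpace ℝ (Fin d),
          (∫⁻ v in Metric.ball w R, auxKernel d K R v w) ≤
            ENNReal.ofReal (C * R ^ (2 - 2 * s))) := by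
  obtain ⟨C1, h1, H1⟩ := aux_first d hd s Λ hs.2 hΛ
  obtain ⟨C2, h2, H2⟩ := aux_second d hd s Λ hs.2 hΛ
  refine ⟨C1 + C2 + 1, by positivity, ?_⟩
  intro K hK ht R hR
  have hRp : 0 ≤ R ^ (2 - 2 * s) := by positivity
  refine ⟨fun v => (H1 K hK ht R hR v).trans ?_, fun w => (H2 K hK ht R hR w).trans ?_⟩
  · apply ENNReal.ofReal_le_ofReal
    gcongr
    linarith
  · apply ENNReal.ofReal_le_ofReal
    gcongr
    linarith
end
end
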